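/- arXiv:1803.02056 — 3 statements merged into one kernel-verified Lean document; each statement's English description precedes it below -/
import Mathlib

section
/- (Rédei) Let D = p_1*⋯p_k* < 0 be a fundamental discriminant written as a product of k prime fundamental discriminants, and let M be its Rédei matrix over F_2. imagThen the 4-rank of the class group satisfies rk_4(Cl(D)) = k − 1 − rank_{F_2}(M). -/
open NumberField

/-- `D` is a fundamental discriminant: either `D ≡ 1 (mod 4)` and `D` is squarefree,
or `D = 4m` for a squarefree integer `m ≡ 2` or `3 (mod 4)`. (We exclude the degenerate
case `D = 1`, so that `D` is the discriminant of a quadratic number field.) -/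
def IsFundamentalDiscriminant (D : ℤ) : Prop :=
  D ≠ 1 ∧ ((D % 4 = 1 ∧ Squarefree D) ∨
    ∃ m : ℤ, D = 4 * m ∧ Squarefree m ∧ (m % 4 = 2 ∨ m % 4 = 3))

/-- The Kronecker symbol `(a/q)` for a prime number `q`: the Legendre (Jacobi) symbol for odd
`q`, and for `q = 2` it is `1` if `a ≡ ±1 (mod 8)`, `-1` if `a ≡ ±3 (mod 8)` and `0` for
even `a`. -/
def kroneckerAtPrime (a : ℤ) (q : ℕ) : ℤ :=
  if q = 2 then
    (if a % 8 = 1 ∨ a % 8 = 7 then 1 else if a % 8 = 3 ∨ a % 8 = 5 then -1 else 0)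
  else jacobiSym a q

/-- The Rédei matrix `M = (c_{ij}) ∈ F_2^{k×k}` attached to the primes `p i` with prime
fundamental discriminants `pstar i`: for `i ≠ j` the entry `c_{ij}` is defined by
`(-1)^{c_{ij}} = (pstar j / p i)` (Kronecker symbol), and `c_{ii} = ∑_{j ≠ i} c_{ij}`. -/
def redeiMatrix {k : ℕ} (p : Fin k → ℕ) (pstar : Fin k → ℤ) :
    Matrix (Fin k) (Fin k) (ZMod 2) :=
  Matrix.of fun i j =>
    if i = j then
      ∑ l ∈ Finset.univ.erase i, (if kroneckerAtPrime (pstar l) (p i) = 1 then 0 else 1)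
    else if kroneckerAtPrime (pstar j) (p i) = 1 then 0 else 1

theorem exists_trace_norm_discr {K : Type*} [Field K] [NumberField K]
    (hdeg : Module.finrank ℚ K = 2) (α : 𝓞 K) :
    ∃ t n y : ℤ, α ^ 2 = t * α - n ∧ t ^ 2 - 4 * n = discr K * y ^ 2 ∧
      Ideal.absNorm (Ideal.span {α}) = n.natAbs := by
  have hr : Module.finrank ℤ (𝓞 K) = 2 := by rw [RingOfIntegers.rank, hdeg]
  let b := Module.finBasisOfFinrankEq ℤ (𝓞 K) hr
  have hch : α ^ 2 = (Algebra.trace ℤ (𝓞 K) α : ℤ) * α - (Algebra.norm ℤ α : ℤ) := by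
    have h1 := Matrix.aeval_self_charpoly (Algebra.leftMulMatrix b α)
    rw [Matrix.charpoly_fin_two, ← Algebra.trace_eq_matrix_trace b,
      ← Algebra.norm_eq_matrix_det b] at h1
    have h2 : Algebra.leftMulMatrix b (α ^ 2 - (Algebra.trace ℤ (𝓞 K) α : ℤ) * α
        + (Algebra.norm ℤ α : ℤ)) = 0 := by
      simpa [Algebra.algebraMap_eq_smul_one] using h1
    have h3 := (map_eq_zero_iff _ (Algebra.leftMulMatrix_injective b)).1 h2
    linear_combination h3
  let P : Matrix (Fin 2) (Fin 2) ℤ := Matrix.of fun i j => b.repr (![1, α] i) j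
  have hP : (P.map (algebraMap ℤ (𝓞 K))).mulVec b = ![1, α] := by
    ext1 i
    have := b.sum_repr (![1, α] i)
    simpa [Matrix.mulVec, dotProduct, P] using this
  refine ⟨Algebra.trace ℤ (𝓞 K) α, Algebra.norm ℤ α, P.det, hch, ?_,
    Ideal.absNorm_span_singleton α⟩
  have h4 := Algebra.discr_of_matrix_mulVec (A := ℤ) b P
  rw [hP, discr_eq_discr] at h4
  have ht1 : Algebra.trace ℤ (𝓞 K) 1 = 2 := by
    have := Algebra.trace_algebraMap_of_basis b (1 : ℤ)
    simpa using this
  have ht2 : Algebra.trace ℤ (𝓞 K) (α * α) =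
      Algebra.trace ℤ (𝓞 K) α ^ 2 - 2 * Algebra.norm ℤ α := by
    have : α * α = (Algebra.trace ℤ (𝓞 K) α) • α - (Algebra.norm ℤ α) • (1 : 𝓞 K) := by
      rw [← sq, hch]; simp
    rw [this, map_sub, map_smul, map_smul, ht1]
    simp only [smul_eq_mul]; ring
  rw [Algebra.discr_def, Matrix.det_fin_two] at h4
  simp only [Algebra.traceMatrix_apply, Algebra.traceForm_apply, Matrix.cons_val_zero,
    Matrix.cons_val_one, mul_one, one_mul, ht1, ht2] at h4
  linear_combination h4

theorem exists_trace_norm_ne {K : Type*} [Field K] [NumberField K]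
    (hdeg : Module.finrank ℚ K = 2) :
    ∃ (α : 𝓞 K) (t n y : ℤ), α ^ 2 = t * α - n ∧ t ^ 2 - 4 * n = discr K * y ^ 2 ∧ y ≠ 0 := by
  have hr : Module.finrank ℤ (𝓞 K) = 2 := by rw [RingOfIntegers.rank, hdeg]
  by_contra! H
  have key : ∀ α : 𝓞 K, ∃ t : ℤ, 2 * α = t := by
    intro α
    obtain ⟨t, n, y, h1, h2, -⟩ := exists_trace_norm_discr hdeg α
    have hy := H α t n y h1 h2
    subst hy
    refine ⟨t, ?_⟩
    have h3 : ((t : 𝓞 K) ^ 2 - 4 * n) = 0 := by exact_mod_cast (by simpa using h2)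
    have : (2 * α - t) ^ 2 = 0 := by linear_combination 4 * h1 + h3
    exact sub_eq_zero.1 (pow_eq_zero_iff (two_ne_zero) |>.1 this)
  let b := Module.finBasisOfFinrankEq ℤ (𝓞 K) hr
  obtain ⟨s, hs⟩ := key (b 0)
  obtain ⟨t, ht⟩ := key (b 1)
  have hli := Fintype.linearIndependent_iff.1 b.linearIndependent ![t, -s] (by
    simp only [Fin.sum_univ_two, Matrix.cons_val_zero, Matrix.cons_val_one, zsmul_eq_mul,
      Int.cast_neg]
    rw [← hs, ← ht]; ring)
  have h1 := hli 0
  simp only [Matrix.cons_val_zero] at h1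
  rw [h1] at ht
  have : b 1 = 0 := by simpa using ht
  exact b.ne_zero 1 this

theorem intCast_dvd_of_sq_eq {K : Type*} [Field K] [NumberField K] {x : 𝓞 K} {q t n : ℤ}
    (hq : q ≠ 0) (h : x ^ 2 = q * t * x - q ^ 2 * n) : (q : 𝓞 K) ∣ x := by
  have hq' : (q : K) ≠ 0 := by exact_mod_cast hq
  have hx : (x : K) ^ 2 = q * t * x - q ^ 2 * n := by
    simpa using congrArg (algebraMap (𝓞 K) K) h
  have hi : IsIntegral ℤ ((x : K) / q) := by
    refine ⟨Polynomial.X ^ 2 - Polynomial.C t * Polynomial.X + Polynomial.C n, ?_, ?_⟩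
    · monicity!
    · simp only [Polynomial.eval₂_add, Polynomial.eval₂_sub, Polynomial.eval₂_pow,
        Polynomial.eval₂_X, Polynomial.eval₂_mul, Polynomial.eval₂_C, algebraMap_int_eq,
        Int.coe_castRingHom]
      field_simp
      linear_combination hx
  obtain ⟨z, hz⟩ := IsIntegralClosure.isIntegral_iff (A := 𝓞 K) |>.1 hi
  refine ⟨z, RingOfIntegers.coe_injective ?_⟩
  rw [map_mul, map_intCast, hz]
  field_simp

theorem exists_sq_eq_discr {K : Type*} [Field K] [NumberField K]
    (hdeg : Module.finrank ℚ K = 2) : ∃ δ : 𝓞 K, δ ^ 2 = (discr K : ℤ) := by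
  obtain ⟨α, t, n, y, h1, h2, hy⟩ := exists_trace_norm_ne hdeg
  have h2' : ((t : 𝓞 K) ^ 2 - 4 * n) = discr K * y ^ 2 := by exact_mod_cast h2
  obtain ⟨δ, hδ⟩ := intCast_dvd_of_sq_eq (x := 2 * α - (t : 𝓞 K)) (q := y) (t := 0)
    (n := -discr K) hy
    (by push_cast; linear_combination 4 * h1 + h2')
  refine ⟨δ, ?_⟩
  have hy' : (y : 𝓞 K) ^ 2 ≠ 0 := by exact_mod_cast pow_ne_zero 2 hy
  apply mul_left_cancel₀ hy'
  rw [← mul_pow, ← hδ]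
  linear_combination 4 * h1 + h2'

theorem exists_sq_eq_of_discr_eq {K : Type*} [Field K] [NumberField K]
    (hdeg : Module.finrank ℚ K = 2) {m : ℤ} (hm : discr K = 4 * m) : ∃ ω : 𝓞 K, ω ^ 2 = m := by
  obtain ⟨δ, hδ⟩ := exists_sq_eq_discr (K := K) hdeg
  rw [hm] at hδ
  obtain ⟨ω, hω⟩ := intCast_dvd_of_sq_eq (x := δ) (q := 2) (t := 0) (n := -m) two_ne_zero
    (by push_cast at hδ ⊢; linear_combination hδ)
  refine ⟨ω, ?_⟩
  have h4 : (4 : 𝓞 K) ≠ 0 := by norm_num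
  apply mul_left_cancel₀ h4
  push_cast at hω hδ
  linear_combination hδ - (δ + 2 * ω) * hω 

theorem intCast_dvd_intCast_ringOfIntegers {K : Type*} [Field K] [NumberField K] {q a : ℤ}
    (h : (q : 𝓞 K) ∣ (a : 𝓞 K)) :
    q ∣ a := by
  rcases eq_or_ne q 0 with rfl | hq
  · simpa using h
  obtain ⟨c, hc⟩ := h
  have hc' : (a : K) = q * c := by
    simpa using congrArg (algebraMap (𝓞 K) K) hc
  have hq' : (q : K) ≠ 0 := by exact_mod_cast hq
  have hi : IsIntegral ℤ ((a : ℚ) / q) := by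
    rw [← isIntegral_algebraMap_iff (algebraMap ℚ K).injective]
    have := c.isIntegral_coe
    convert this using 1
    simp [hc']
    field_simp
  obtain ⟨z, hz⟩ := IsIntegrallyClosed.isIntegral_iff.1 hi
  refine ⟨z, ?_⟩
  have hq'' : (q : ℚ) ≠ 0 := by exact_mod_cast hq
  simp at hz
  field_simp at hz
  rw [mul_comm]
  exact_mod_cast hz.symm

theorem Ideal.span_pair_sq_eq_span_singleton {R : Type*} [CommRing R] {β : R} {q s u : ℤ}
    (hβ : β ^ 2 = q * (s * β - u)) (hu : IsCoprime q u) :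
    Ideal.span {(q : R), β} ^ 2 = Ideal.span {(q : R)} := by
  obtain ⟨a, b, hab⟩ := hu
  have hab' : (a : R) * q + b * u = 1 := by exact_mod_cast congrArg (Int.cast : ℤ → R) hab
  apply le_antisymm
  · rw [sq, Ideal.span_pair_mul_span_pair, Ideal.span_le]
    intro x hx
    simp only [Set.mem_insert_iff, Set.mem_singleton_iff] at hx
    rw [SetLike.mem_coe, Ideal.mem_span_singleton]
    rcases hx with rfl | rfl | rfl | rfl
    · exact Dvd.intro _ rfl
    · exact Dvd.intro _ rfl
    · exact Dvd.intro_left _ rfl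
    · exact ⟨s * β - u, by rw [← sq, hβ]⟩
  · rw [Ideal.span_singleton_le_iff_mem]
    have hq : (q : R) ∈ Ideal.span {(q : R), β} := Ideal.subset_span (by simp)
    have hb : β ∈ Ideal.span {(q : R), β} := Ideal.subset_span (by simp)
    have h1 := Ideal.pow_mem_pow hq 2
    have h2 := Ideal.pow_mem_pow hb 2
    have h3 : (q : R) * β ∈ Ideal.span {(q : R), β} ^ 2 := by
      rw [sq]; exact Ideal.mul_mem_mul hq hb
    have : a * (q : R) ^ 2 + (b * s * ((q : R) * β) - b * β ^ 2) = q := by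
      rw [hβ]; linear_combination (q : R) * hab'
    have hmem := add_mem (Ideal.mul_mem_left _ (a : R) h1)
      (sub_mem (Ideal.mul_mem_left _ (b * s : R) h3) (Ideal.mul_mem_left _ (b : R) h2))
    rwa [this] at hmem

theorem exists_ideal_sq_eq_span_prime {K : Type*} [Field K] [NumberField K]
    (hdeg : Module.finrank ℚ K = 2) (hfund : IsFundamentalDiscriminant (discr K))
    {q : ℕ} (hq : q.Prime) (hqD : (q : ℤ) ∣ discr K) :
    ∃ I : Ideal (𝓞 K), I ^ 2 = Ideal.span {(q : 𝓞 K)} := by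
  suffices ∃ (β : 𝓞 K) (s u : ℤ), β ^ 2 = (q : ℤ) * (s * β - u) ∧ IsCoprime (q : ℤ) u by
    obtain ⟨β, s, u, h, hu⟩ := this
    have := Ideal.span_pair_sq_eq_span_singleton h hu
    rw [Int.cast_natCast] at this
    exact ⟨_, this⟩
  have hqp : Prime (q : ℤ) := Nat.prime_iff_prime_int.1 hq
  have hsf : ∀ m : ℤ, Squarefree m → (q : ℤ) ∣ m → ∀ β : 𝓞 K, β ^ 2 = m →
      ∃ (β : 𝓞 K) (s u : ℤ), β ^ 2 = (q : ℤ) * (s * β - u) ∧ IsCoprime (q : ℤ) u := by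
    rintro m hm ⟨u, rfl⟩ β hβ
    refine ⟨β, 0, -u, by rw [hβ]; push_cast; ring, ?_⟩
    rw [IsCoprime.neg_right_iff]
    rw [Prime.coprime_iff_not_dvd hqp]
    intro h
    have := hm q (mul_dvd_mul_left _ h)
    exact hqp.not_isUnit this
  obtain ⟨-, ⟨-, h⟩ | ⟨m, hm, hmsf, hm4⟩⟩ := hfund
  · obtain ⟨δ, hδ⟩ := exists_sq_eq_discr (K := K) hdeg
    exact hsf _ h hqD δ hδ
  · obtain ⟨ω, hω⟩ := exists_sq_eq_of_discr_eq hdeg hm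
    by_cases hqm : (q : ℤ) ∣ m
    · exact hsf m hmsf hqm ω hω
    · have hq2 : q = 2 := by
        rw [hm] at hqD
        have h4 := (hqp.dvd_mul.1 hqD).resolve_right hqm
        have : (q : ℤ) ∣ 2 := hqp.dvd_of_dvd_pow (n := 2) (by norm_num; exact h4)
        exact (Nat.prime_dvd_prime_iff_eq hq Nat.prime_two).1 (by exact_mod_cast this)
      subst hq2
      have hm3 : m % 4 = 3 := by
        rcases hm4 with h | h
        · exact absurd (by push_cast; omega) hqm
        · exact h
      refine ⟨1 + ω, 1, -(2 * (m / 4) + 1), ?_, ?_⟩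
      · have : (m : 𝓞 K) = 4 * (m / 4 : ℤ) + 3 := by
          exact_mod_cast congrArg (Int.cast : ℤ → 𝓞 K) (by omega : m = 4 * (m / 4) + 3)
        push_cast
        linear_combination hω + this
      · exact ⟨- (m / 4), -1, by push_cast; ring⟩

theorem exists_trace_norm_nonneg {K : Type*} [Field K] [NumberField K]
    (hdeg : Module.finrank ℚ K = 2) (hneg : discr K < 0) (α : 𝓞 K) :
    ∃ (t y : ℤ) (n : ℕ), α ^ 2 = t * α - n ∧ t ^ 2 - 4 * (n : ℤ) = discr K * y ^ 2 ∧
      Ideal.absNorm (Ideal.span {α}) = n := by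
  obtain ⟨t, n, y, h1, h2, h3⟩ := exists_trace_norm_discr hdeg α
  have hn : 0 ≤ n := by nlinarith [sq_nonneg t, sq_nonneg y]
  lift n to ℕ using hn
  exact ⟨t, y, n, by simpa using h1, h2, by simpa using h3⟩

theorem dvd_of_dvd_sq_of_not_dvd_discr {K : Type*} [Field K] [NumberField K]
    (hdeg : Module.finrank ℚ K = 2) (hneg : discr K < 0)
    (hfund : IsFundamentalDiscriminant (discr K))
    {q : ℕ} (hq : q.Prime) (hqD : ¬ (q : ℤ) ∣ discr K) {x : 𝓞 K}
    (hx : (q : 𝓞 K) ∣ x ^ 2) : (q : 𝓞 K) ∣ x := by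
  have hqp : Prime (q : ℤ) := Nat.prime_iff_prime_int.1 hq
  obtain ⟨t, y, n, h1, h2, h3⟩ := exists_trace_norm_nonneg hdeg hneg x
  have hqn : q ∣ n := by
    obtain ⟨z, hz⟩ := hx
    have h4 : Ideal.absNorm (Ideal.span {x}) ^ 2 =
        Ideal.absNorm (Ideal.span {(q : 𝓞 K)}) * Ideal.absNorm (Ideal.span {z}) := by
      rw [← map_pow, ← map_mul, Ideal.span_singleton_pow, Ideal.span_singleton_mul_span_singleton,
        hz]
    have h5 : q ∣ Ideal.absNorm (Ideal.span {(q : 𝓞 K)}) := by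
      rw [Ideal.absNorm_span_singleton, ← Int.natCast_dvd]
      have := Algebra.norm_algebraMap_of_basis
        (Module.finBasisOfFinrankEq ℤ (𝓞 K) (by rw [RingOfIntegers.rank, hdeg] : _ = 2)) (q : ℤ)
      simp at this
      rw [this]
      exact dvd_pow_self _ two_ne_zero
    rw [h3] at h4
    exact hq.dvd_of_dvd_pow (h4 ▸ h5.mul_right _)
  obtain ⟨n', rfl⟩ := hqn
  by_cases hqt : (q : ℤ) ∣ t
  · obtain ⟨t', rfl⟩ := hqt
    suffices h : (q : ℤ) ∣ n' by
      obtain ⟨n'', hn⟩ := h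
      have := intCast_dvd_of_sq_eq (x := x) (q := q) (t := t') (n := n'')
        (by exact_mod_cast hq.ne_zero) (by
          have hn' : (n' : 𝓞 K) = q * n'' := by exact_mod_cast congrArg (Int.cast : ℤ → 𝓞 K) hn
          rw [h1]; push_cast; rw [hn']; ring)
      simpa using this
    have hy : (q : ℤ) ∣ y := by
      refine hqp.dvd_of_dvd_pow (n := 2)
        (Or.resolve_left (hqp.dvd_mul.1 (?_ : (q : ℤ) ∣ discr K * y ^ 2)) hqD)
      rw [← h2]
      exact ⟨q * t' ^ 2 - 4 * n', by push_cast; ring⟩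
    obtain ⟨y', rfl⟩ := hy
    have hq0 : (q : ℤ) ≠ 0 := by exact_mod_cast hq.ne_zero
    have h6 : 4 * (n' : ℤ) = q * (t' ^ 2 - discr K * y' ^ 2) := by
      apply mul_left_cancel₀ hq0
      push_cast at h2
      linear_combination -h2
    rcases eq_or_ne q 2 with rfl | hq2
    · have h7 : discr K % 4 = 1 := by
        obtain ⟨-, ⟨h, -⟩ | ⟨m, hm, -⟩⟩ := hfund
        · exact h
        · exact absurd ⟨2 * m, by push_cast; rw [hm]; ring⟩ hqD
      obtain ⟨d, hd⟩ : ∃ d, discr K = 4 * d + 1 := ⟨discr K / 4, by omega⟩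
      rw [hd] at h6
      have h8 : 2 * (n' : ℤ) = t' ^ 2 - (4 * d + 1) * y' ^ 2 := by
        push_cast at h6; linarith
      have h9 : Even (t' - y') := by
        have : Even (t' ^ 2 - y' ^ 2) := ⟨n' + 2 * d * y' ^ 2, by linear_combination -h8⟩
        simpa [Int.even_sub, Int.even_pow] using this
      obtain ⟨c, hc⟩ := h9
      obtain rfl : t' = y' + c + c := by linarith
      exact ⟨c * y' + c ^ 2 - d * y' ^ 2, by push_cast; linarith⟩
    · have h10 : (q : ℤ) ∣ 4 * n' := ⟨_, h6⟩
      refine (hqp.dvd_mul.1 h10).resolve_left fun h => hq2 ?_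
      have : (q : ℤ) ∣ 2 := hqp.dvd_of_dvd_pow (n := 2) (by norm_num; exact h)
      exact (Nat.prime_dvd_prime_iff_eq hq Nat.prime_two).1 (by exact_mod_cast this)
  · obtain ⟨a, b, hab⟩ := (Prime.coprime_iff_not_dvd hqp).2 hqt
    have hab' : (a : 𝓞 K) * q + b * t = 1 := by
      exact_mod_cast congrArg (Int.cast : ℤ → 𝓞 K) hab
    obtain ⟨z, hz⟩ := hx
    refine ⟨a * x + b * (z + n'), ?_⟩
    push_cast at h1
    linear_combination (-x) * hab' - b * h1 + b * hz 

theorem span_dvd_of_dvd_sq_of_not_dvd_discr {K : Type*} [Field K] [NumberField K]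
    (hdeg : Module.finrank ℚ K = 2) (hneg : discr K < 0)
    (hfund : IsFundamentalDiscriminant (discr K))
    {q : ℕ} (hq : q.Prime) (hqD : ¬ (q : ℤ) ∣ discr K) {I : Ideal (𝓞 K)}
    (hI : Ideal.span {(q : 𝓞 K)} ∣ I ^ 2) : Ideal.span {(q : 𝓞 K)} ∣ I := by
  rw [Ideal.dvd_iff_le] at hI ⊢
  intro x hx
  rw [Ideal.mem_span_singleton]
  apply dvd_of_dvd_sq_of_not_dvd_discr hdeg hneg hfund hq hqD
  rw [← Ideal.mem_span_singleton]
  exact hI (Ideal.pow_mem_pow hx 2)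

open nonZeroDivisors in
theorem mk0_mem_closure_of_sq_eq_span {K : Type*} [Field K] [NumberField K]
    (hdeg : Module.finrank ℚ K = 2) (hneg : discr K < 0)
    (hfund : IsFundamentalDiscriminant (discr K))
    {ι : Type*} (p : ι → ℕ)
    (hpD : ∀ q : ℕ, q.Prime → (q : ℤ) ∣ discr K → ∃ i, p i = q)
    (P : ι → (Ideal (𝓞 K))⁰) (hP : ∀ i, (P i : Ideal (𝓞 K)) ^ 2 = Ideal.span {(p i : 𝓞 K)})
    (r : ℕ) (hr : r ≠ 0) (I : (Ideal (𝓞 K))⁰)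
    (hI : (I : Ideal (𝓞 K)) ^ 2 = Ideal.span {(r : 𝓞 K)}) :
    ClassGroup.mk0 I ∈ Subgroup.closure (Set.range fun i => ClassGroup.mk0 (P i)) := by
  induction r using Nat.strong_induction_on generalizing I with
  | _ r ih =>
  rcases eq_or_ne r 1 with rfl | hr1
  · have h1 : (I : Ideal (𝓞 K)) = 1 := by
      have : (I : Ideal (𝓞 K)) ^ 2 = 1 := by simpa using hI
      have h2 : IsUnit ((I : Ideal (𝓞 K)) ^ 2) := by rw [this]; exact isUnit_one
      rwa [isUnit_pow_iff two_ne_zero, Ideal.isUnit_iff, ← Ideal.one_eq_top] at h2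
    have : I = 1 := Subtype.ext h1
    rw [this, map_one]
    exact one_mem _
  obtain ⟨q, hq, s, rfl⟩ := Nat.exists_prime_and_dvd hr1
  have hs : s ≠ 0 := by rintro rfl; simp at hr
  have hlt : s < q * s := lt_mul_of_one_lt_left (Nat.pos_of_ne_zero hs) hq.one_lt
  have hq0 : Ideal.span {(q : 𝓞 K)} ≠ 0 := by
    simpa using hq.ne_zero
  have hIq : (I : Ideal (𝓞 K)) ^ 2 = Ideal.span {(q : 𝓞 K)} * Ideal.span {(s : 𝓞 K)} := by
    rw [hI, Ideal.span_singleton_mul_span_singleton, Nat.cast_mul]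
  by_cases hqD : (q : ℤ) ∣ discr K
  · obtain ⟨i, rfl⟩ := hpD q hq hqD
    have hdvd : (P i : Ideal (𝓞 K)) ∣ I := by
      rw [← UniqueFactorizationMonoid.pow_dvd_pow_iff_dvd two_ne_zero, hP, hIq]
      exact dvd_mul_right _ _
    obtain ⟨J, hJ⟩ := hdvd
    have hJ0 : J ∈ (Ideal (𝓞 K))⁰ := by
      rw [mem_nonZeroDivisors_iff_ne_zero]
      rintro rfl
      exact nonZeroDivisors.coe_ne_zero I (by simpa using hJ)
    have hIJ : I = P i * ⟨J, hJ0⟩ := Subtype.ext hJ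
    rw [hIJ, map_mul]
    refine mul_mem (Subgroup.subset_closure ⟨i, rfl⟩) (ih s hlt hs ⟨J, hJ0⟩ ?_)
    apply mul_left_cancel₀ hq0
    rw [← hIq, hJ, mul_pow, hP]
  · obtain ⟨J, hJ⟩ := span_dvd_of_dvd_sq_of_not_dvd_discr hdeg hneg hfund hq hqD
      (Dvd.intro _ hIq.symm)
    have hJ0 : J ∈ (Ideal (𝓞 K))⁰ := by
      rw [mem_nonZeroDivisors_iff_ne_zero]
      rintro rfl
      exact nonZeroDivisors.coe_ne_zero I (by simpa using hJ)
    have hs' : Ideal.span {(q : 𝓞 K)} * J ^ 2 = Ideal.span {(s : 𝓞 K)} := by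
      apply mul_left_cancel₀ hq0
      rw [← hIq, hJ]; ring
    have hqs : q ∣ s := by
      have : Ideal.span {(q : 𝓞 K)} ∣ Ideal.span {(s : 𝓞 K)} := Dvd.intro _ hs'
      rw [Ideal.dvd_span_singleton, Ideal.mem_span_singleton] at this
      have h := intCast_dvd_intCast_ringOfIntegers (q := q) (a := s) (by simpa using this)
      exact_mod_cast h
    obtain ⟨s', rfl⟩ := hqs
    have hs0 : s' ≠ 0 := by rintro rfl; simp at hs
    have hlt' : s' < q * s' := lt_mul_of_one_lt_left (Nat.pos_of_ne_zero hs0) hq.one_lt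
    have hIJ : ClassGroup.mk0 I = ClassGroup.mk0 ⟨J, hJ0⟩ := by
      rw [ClassGroup.mk0_eq_mk0_iff]
      exact ⟨1, q, one_ne_zero, by exact_mod_cast hq.ne_zero, by simpa using hJ⟩
    rw [hIJ]
    refine ih s' (hlt'.trans hlt) hs0 ⟨J, hJ0⟩ ?_
    apply mul_left_cancel₀ hq0
    rw [hs', Nat.cast_mul, Ideal.span_singleton_mul_span_singleton]

open nonZeroDivisors in
theorem mem_closure_of_sq_eq_one {K : Type*} [Field K] [NumberField K]
    (hdeg : Module.finrank ℚ K = 2) (hneg : discr K < 0)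
    (hfund : IsFundamentalDiscriminant (discr K))
    {ι : Type*} (p : ι → ℕ)
    (hpD : ∀ q : ℕ, q.Prime → (q : ℤ) ∣ discr K → ∃ i, p i = q)
    (P : ι → (Ideal (𝓞 K))⁰) (hP : ∀ i, (P i : Ideal (𝓞 K)) ^ 2 = Ideal.span {(p i : 𝓞 K)})
    (c : ClassGroup (𝓞 K)) (hc : c ^ 2 = 1) :
    c ∈ Subgroup.closure (Set.range fun i => ClassGroup.mk0 (P i)) := by
  have key := mk0_mem_closure_of_sq_eq_span hdeg hneg hfund p hpD P hP
  obtain ⟨I, rfl⟩ := ClassGroup.mk0_surjective c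
  obtain ⟨α, hα⟩ : ∃ α, (I : Ideal (𝓞 K)) ^ 2 = Ideal.span {α} := by
    have h2 : (I : Ideal (𝓞 K)) ^ 2 ∈ (Ideal (𝓞 K))⁰ := pow_mem I.2 2
    have hc2 : ClassGroup.mk0 ⟨(I : Ideal (𝓞 K)) ^ 2, h2⟩ = 1 := by
      rw [← hc, ← map_pow]
      rfl
    exact ((ClassGroup.mk0_eq_one_iff h2).1 hc2).principal
  have hI0 : (I : Ideal (𝓞 K)) ≠ 0 := nonZeroDivisors.coe_ne_zero I
  have hα0 : α ≠ 0 := by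
    rintro rfl
    exact pow_ne_zero 2 hI0 (by simpa using hα)
  obtain ⟨t, y, n, h1, h2, h3⟩ := exists_trace_norm_nonneg hdeg hneg α
  set N := Ideal.absNorm (I : Ideal (𝓞 K)) with hN
  have hN0 : N ≠ 0 := by rw [hN, Ne, Ideal.absNorm_eq_zero_iff]; exact hI0
  have hn : n = N ^ 2 := by rw [← h3, ← hα, map_pow]
  subst hn
  by_cases hβ : α + N = 0
  · apply key N hN0
    rw [hα, ← Ideal.span_singleton_neg, ← eq_neg_of_add_eq_zero_left (by rw [add_comm]; exact hβ)]
  · have hβ2 : (α + N) ^ 2 = α * (t + 2 * N : ℤ) := by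
      push_cast at h1 ⊢
      linear_combination h1
    obtain ⟨J, hJ⟩ : (I : Ideal (𝓞 K)) ∣ Ideal.span {α + (N : 𝓞 K)} := by
      rw [← UniqueFactorizationMonoid.pow_dvd_pow_iff_dvd two_ne_zero, hα,
        Ideal.span_singleton_pow, hβ2,
        ← Ideal.span_singleton_mul_span_singleton]
      exact dvd_mul_right _ _
    have hJ0 : J ∈ (Ideal (𝓞 K))⁰ := by
      rw [mem_nonZeroDivisors_iff_ne_zero]
      rintro rfl
      exact hβ (by simpa using hJ)
    have hr0 : (t + 2 * N : ℤ) ≠ 0 := by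
      intro h
      rw [h] at hβ2
      exact hβ (by simpa using hβ2)
    have hIJ : ClassGroup.mk0 I = (ClassGroup.mk0 ⟨J, hJ0⟩)⁻¹ := by
      rw [ClassGroup.mk0_eq_mk0_inv_iff]
      exact ⟨_, hβ, hJ.symm⟩
    rw [hIJ]
    refine inv_mem (key (t + 2 * N : ℤ).natAbs (by simpa using hr0) _ ?_)
    have hα' : Ideal.span {α} ≠ 0 := by simpa using hα0
    apply mul_left_cancel₀ hα'
    have : Ideal.span {(((t + 2 * N : ℤ).natAbs : ℕ) : 𝓞 K)} =
        Ideal.span {((t + 2 * N : ℤ) : 𝓞 K)} := by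
      rcases Int.natAbs_eq (t + 2 * N : ℤ) with h | h
      · conv_rhs => rw [h, Int.cast_natCast]
      · conv_rhs => rw [h, Int.cast_neg, Int.cast_natCast, Ideal.span_singleton_neg]
    rw [this, Ideal.span_singleton_mul_span_singleton, ← hβ2, ← Ideal.span_singleton_pow, hJ,
      mul_pow, hα]

theorem exists_span_sq_eq_squarefree {K : Type*} [Field K] [NumberField K]
    (hdeg : Module.finrank ℚ K = 2) (hneg : discr K < 0)
    (hfund : IsFundamentalDiscriminant (discr K)) :
    ∃ (γ : 𝓞 K) (r : ℤ), Ideal.span {γ} ^ 2 = Ideal.span {(r : 𝓞 K)} ∧ Squarefree r ∧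
      r.natAbs ≠ 1 ∧ r ∣ discr K := by
  obtain ⟨-, ⟨h4, h⟩ | ⟨m, hm, hmsf, hm4⟩⟩ := hfund
  · obtain ⟨δ, hδ⟩ := exists_sq_eq_discr (K := K) hdeg
    exact ⟨δ, discr K, by rw [Ideal.span_singleton_pow, hδ], h, by omega, dvd_rfl⟩
  · obtain ⟨ω, hω⟩ := exists_sq_eq_of_discr_eq hdeg hm
    rcases eq_or_ne m (-1) with rfl | hm1
    · refine ⟨1 + ω, 2, ?_, Int.prime_two.squarefree, by decide, ⟨-2, by rw [hm]; norm_num⟩⟩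
      have h1 : (1 + ω) ^ 2 = 2 * ω := by push_cast at hω; linear_combination hω
      have h2 : IsUnit ω := IsUnit.of_mul_eq_one (-ω) (by push_cast at hω; linear_combination -hω)
      rw [Ideal.span_singleton_pow, h1, Ideal.span_singleton_mul_right_unit h2]
      norm_cast
    · exact ⟨ω, m, by rw [Ideal.span_singleton_pow, hω], hmsf, by omega, ⟨4, by rw [hm]; ring⟩⟩

theorem Ideal.span_natCast_natAbs {R : Type*} [CommRing R] (r : ℤ) :
    Ideal.span {(r.natAbs : R)} = Ideal.span {(r : R)} := by
  rcases Int.natAbs_eq r with h | h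
  · conv_rhs => rw [h, Int.cast_natCast]
  · conv_rhs => rw [h, Int.cast_neg, Int.cast_natCast, Ideal.span_singleton_neg]

open nonZeroDivisors in
theorem exists_prod_mk0_eq_one {K : Type*} [Field K] [NumberField K]
    (hdeg : Module.finrank ℚ K = 2) (hneg : discr K < 0)
    (hfund : IsFundamentalDiscriminant (discr K))
    {ι : Type*} [Fintype ι] (p : ι → ℕ) (hp : ∀ i, (p i).Prime) (hinj : p.Injective)
    (hpD : ∀ q : ℕ, q.Prime → (q : ℤ) ∣ discr K → ∃ i, p i = q)
    (P : ι → (Ideal (𝓞 K))⁰) (hP : ∀ i, (P i : Ideal (𝓞 K)) ^ 2 = Ideal.span {(p i : 𝓞 K)}) :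
    ∃ S : Finset ι, S.Nonempty ∧ ∏ i ∈ S, ClassGroup.mk0 (P i) = 1 := by
  classical
  obtain ⟨γ, r, hγ, hsf, hr1, hrD⟩ := exists_span_sq_eq_squarefree hdeg hneg hfund
  let S : Finset ι := Finset.univ.filter fun i => p i ∣ r.natAbs
  have hS : S.image p = r.natAbs.primeFactors := by
    ext q
    simp only [Finset.mem_image, S, Finset.mem_filter, Finset.mem_univ, true_and,
      Nat.mem_primeFactors]
    constructor
    · rintro ⟨i, hi, rfl⟩
      exact ⟨hp i, hi, by simpa using hsf.ne_zero⟩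
    · rintro ⟨hq, hqr, -⟩
      obtain ⟨i, rfl⟩ := hpD q hq ((Int.natCast_dvd.2 hqr).trans hrD)
      exact ⟨i, hqr, rfl⟩
  have hprod : ∏ i ∈ S, p i = r.natAbs := by
    rw [← Nat.prod_primeFactors_of_squarefree (Int.squarefree_natAbs.2 hsf), ← hS,
      Finset.prod_image fun i _ j _ h => hinj h]
  refine ⟨S, ?_, ?_⟩
  · rw [Finset.nonempty_iff_ne_empty]
    intro h
    rw [h, Finset.prod_empty] at hprod
    exact hr1 hprod.symm
  · have hsq : ((∏ i ∈ S, P i : (Ideal (𝓞 K))⁰) : Ideal (𝓞 K)) ^ 2 = Ideal.span {γ} ^ 2 := by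
      rw [Submonoid.coe_finsetProd, ← Finset.prod_pow, Finset.prod_congr rfl fun i _ => hP i,
        Ideal.prod_span_singleton, ← Nat.cast_prod, hprod, hγ, Ideal.span_natCast_natAbs]
    have heq : ((∏ i ∈ S, P i : (Ideal (𝓞 K))⁰) : Ideal (𝓞 K)) = Ideal.span {γ} :=
      dvd_antisymm
        ((UniqueFactorizationMonoid.pow_dvd_pow_iff_dvd two_ne_zero).1 hsq.dvd)
        ((UniqueFactorizationMonoid.pow_dvd_pow_iff_dvd two_ne_zero).1 hsq.symm.dvd)
    rw [← map_prod, ClassGroup.mk0_eq_one_iff (SetLike.coe_mem _), heq]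
    exact ⟨γ, rfl⟩

theorem Ideal.coprime_absNorm_of_sup_span_eq_top {R : Type*} [CommRing R] [IsDedekindDomain R]
    [Module.Free ℤ R] [Module.Finite ℤ R] {I : Ideal R} {N : ℕ} (hI0 : I ≠ ⊥)
    (hI : I ⊔ Ideal.span {(N : R)} = ⊤) : (Ideal.absNorm I).Coprime N := by
  refine Nat.coprime_of_dvd fun q hq hqI hqN => ?_
  have : Finite (R ⧸ I) := Ideal.finiteQuotientOfFreeOfNeBot I hI0
  have : Fact q.Prime := ⟨hq⟩
  obtain ⟨x, hx⟩ := exists_prime_addOrderOf_dvd_card' (G := R ⧸ I) q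
    (by rw [← Submodule.cardQuot_apply]; exact hqI)
  obtain ⟨M, rfl⟩ := hqN
  have h1 : (1 : R) ∈ I ⊔ Ideal.span {((q * M : ℕ) : R)} := hI ▸ Submodule.mem_top
  obtain ⟨a, ha, b, hb, hab⟩ := Submodule.mem_sup.1 h1
  obtain ⟨c, rfl⟩ := Ideal.mem_span_singleton.1 hb
  have h2 : (q : R ⧸ I) * x = 0 := by
    rw [← nsmul_eq_mul, ← hx]; exact addOrderOf_nsmul_eq_zero x
  have h3 : x = 0 := by
    have h4 := congrArg (Ideal.Quotient.mk I) hab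
    rw [map_add, Ideal.Quotient.eq_zero_iff_mem.2 ha, map_mul, map_natCast, map_one] at h4
    push_cast at h4
    linear_combination (-x) * h4 + (M : R ⧸ I) * (Ideal.Quotient.mk I c) * h2
  rw [h3, addOrderOf_zero] at hx
  exact hq.one_lt.ne hx

open nonZeroDivisors in
theorem ClassGroup.exists_mk0_eq_coprime {R : Type*} [CommRing R] [IsDedekindDomain R]
    (c : ClassGroup R) (J : Ideal R) (hJ : J ≠ ⊥) :
    ∃ I : (Ideal R)⁰, ClassGroup.mk0 I = c ∧ (I : Ideal R) ⊔ J = ⊤ := by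
  obtain ⟨B, hB⟩ := ClassGroup.mk0_surjective c⁻¹
  have hB0 : (B : Ideal R) ≠ 0 := nonZeroDivisors.coe_ne_zero B
  by_cases htop : J = ⊤
  · obtain ⟨I, hI⟩ := ClassGroup.mk0_surjective c
    exact ⟨I, hI, by rw [htop, sup_top_eq]⟩
  obtain ⟨a, ha⟩ := IsDedekindDomain.exists_sup_span_eq (I := (B : Ideal R) * J) (J := B)
    Ideal.mul_le_left (mul_ne_zero hB0 hJ)
  obtain ⟨I, hI⟩ : (B : Ideal R) ∣ Ideal.span {a} := by
    rw [Ideal.dvd_iff_le]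
    exact le_sup_right.trans ha.le
  have hIJ : J ⊔ I = ⊤ := by
    rw [hI, ← Ideal.mul_sup] at ha
    have h : (B : Ideal R) * (J ⊔ I) = B * ⊤ := by rw [ha, Ideal.mul_top]
    exact mul_left_cancel₀ hB0 h
  have ha0 : a ≠ 0 := by
    rintro rfl
    have : I = ⊥ := by
      have h : (B : Ideal R) * I = 0 := by rw [← hI]; simp
      exact (mul_eq_zero.1 h).resolve_left hB0
    rw [this, sup_bot_eq] at hIJ
    exact htop hIJ
  have hI0 : I ∈ (Ideal R)⁰ := by
    rw [mem_nonZeroDivisors_iff_ne_zero]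
    rintro rfl
    exact ha0 (by simpa using hI)
  refine ⟨⟨I, hI0⟩, ?_, by rw [sup_comm]; exact hIJ⟩
  rw [← inv_inv c, ← hB, ClassGroup.mk0_eq_mk0_inv_iff]
  exact ⟨a, ha0, by rw [hI, mul_comm]⟩

open nonZeroDivisors in
theorem exists_classGroup_hom_of_mulChar {K : Type*} [Field K] [NumberField K] {N : ℕ}
    (hN : N ≠ 0) (ψ : MulChar (ZMod N) ℤ)
    (hψ : ∀ α : 𝓞 K, (Ideal.absNorm (Ideal.span {α})).Coprime N →
      ψ (Ideal.absNorm (Ideal.span {α})) = 1) :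
    ∃ X : ClassGroup (𝓞 K) →* ℤˣ, ∀ I : (Ideal (𝓞 K))⁰,
      (Ideal.absNorm (I : Ideal (𝓞 K))).Coprime N →
        (X (ClassGroup.mk0 I) : ℤ) = ψ (Ideal.absNorm (I : Ideal (𝓞 K))) := by
  have hrep : ∀ c : ClassGroup (𝓞 K), ∃ I : (Ideal (𝓞 K))⁰, ClassGroup.mk0 I = c ∧
      (Ideal.absNorm (I : Ideal (𝓞 K))).Coprime N := by
    intro c
    obtain ⟨I, hI, hIN⟩ := ClassGroup.exists_mk0_eq_coprime c (Ideal.span {(N : 𝓞 K)})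
      (by simpa using hN)
    exact ⟨I, hI, Ideal.coprime_absNorm_of_sup_span_eq_top (nonZeroDivisors.coe_ne_zero I) hIN⟩
  choose f hf hfN using hrep
  have hone : ∀ I J : (Ideal (𝓞 K))⁰, ClassGroup.mk0 I = (ClassGroup.mk0 J)⁻¹ →
      (Ideal.absNorm (I : Ideal (𝓞 K))).Coprime N → (Ideal.absNorm (J : Ideal (𝓞 K))).Coprime N →
      ψ (Ideal.absNorm (I : Ideal (𝓞 K))) * ψ (Ideal.absNorm (J : Ideal (𝓞 K))) = 1 := by
    intro I J hIJ hI hJ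
    obtain ⟨α, -, hα⟩ := ClassGroup.mk0_eq_mk0_inv_iff.1 hIJ
    rw [← map_mul, ← Nat.cast_mul, ← map_mul, hα]
    refine hψ α ?_
    rw [← hα, map_mul]
    exact hI.mul_left hJ
  have hwd : ∀ I J : (Ideal (𝓞 K))⁰, ClassGroup.mk0 I = ClassGroup.mk0 J →
      (Ideal.absNorm (I : Ideal (𝓞 K))).Coprime N → (Ideal.absNorm (J : Ideal (𝓞 K))).Coprime N →
      ψ (Ideal.absNorm (I : Ideal (𝓞 K))) = ψ (Ideal.absNorm (J : Ideal (𝓞 K))) := by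
    intro I J hIJ hI hJ
    have h1 := hone I _ (by rw [hf, inv_inv]) hI (hfN (ClassGroup.mk0 I)⁻¹)
    have h2 := hone J _ (by rw [hf, inv_inv, hIJ]) hJ (hfN (ClassGroup.mk0 I)⁻¹)
    exact mul_right_cancel₀ (right_ne_zero_of_mul_eq_one h1) (h1.trans h2.symm)
  let X : ClassGroup (𝓞 K) →* ℤ :=
    { toFun := fun c => ψ (Ideal.absNorm (f c : Ideal (𝓞 K)))
      map_one' := by
        have := hwd (f 1) 1 (by rw [hf, map_one]) (hfN 1) (by simp)
        rw [this]
        simp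
      map_mul' := fun c d => by
        have := hwd (f (c * d)) (f c * f d) (by rw [hf, map_mul, hf, hf]) (hfN _) (by
          rw [Submonoid.coe_mul, map_mul]
          exact (hfN c).mul_left (hfN d))
        rw [this, Submonoid.coe_mul, map_mul, Nat.cast_mul, map_mul] }
  exact ⟨X.toHomUnits, fun I hI => hwd _ _ (hf _) (hfN _) hI⟩

theorem absNorm_span_natCast_of_finrank_eq_two {K : Type*} [Field K] [NumberField K]
    (hdeg : Module.finrank ℚ K = 2) (q : ℕ) :
    Ideal.absNorm (Ideal.span {(q : 𝓞 K)}) = q ^ 2 := by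
  have hr : Module.finrank ℤ (𝓞 K) = 2 := by rw [RingOfIntegers.rank, hdeg]
  have h := Algebra.norm_algebraMap_of_basis (Module.finBasisOfFinrankEq ℤ (𝓞 K) hr) (q : ℤ)
  rw [map_natCast, Fintype.card_fin] at h
  rw [Ideal.absNorm_span_singleton, h, Int.natAbs_pow, Int.natAbs_natCast]

theorem not_natCast_dvd_sqrt_discr_add {K : Type*} [Field K] [NumberField K]
    (hdeg : Module.finrank ℚ K = 2) (hneg : discr K < 0) {δ : 𝓞 K} (hδ : δ ^ 2 = discr K)
    {q : ℕ} {s : ℤ} (hqs : ¬ (q : ℤ) ∣ 2 * s) : ¬ (q : 𝓞 K) ∣ δ + s := by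
  rintro ⟨z, hz⟩
  obtain ⟨t, y, n, h1, -, -⟩ := exists_trace_norm_nonneg hdeg hneg z
  have h2 : ((t * q - 2 * s : ℤ) : 𝓞 K) * δ =
      (discr K + s ^ 2 - t * q * s + n * (q : ℤ) ^ 2 : ℤ) := by
    push_cast
    linear_combination hδ - (δ + s + q * z - t * q) * hz - (q : 𝓞 K) ^ 2 * h1
  have h3 : (t * q - 2 * s) ^ 2 * discr K =
      (discr K + s ^ 2 - t * q * s + n * (q : ℤ) ^ 2) ^ 2 := by
    have h4 := congrArg (· ^ 2) h2
    simp only [mul_pow, hδ] at h4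
    exact_mod_cast h4
  have h4 : (t * q - 2 * s) ^ 2 = 0 := by
    by_contra h
    have h5 : 0 < (t * q - 2 * s) ^ 2 := lt_of_le_of_ne (sq_nonneg _) (Ne.symm h)
    nlinarith [sq_nonneg (discr K + s ^ 2 - t * q * s + n * (q : ℤ) ^ 2)]
  have h5 := pow_eq_zero_iff two_ne_zero |>.1 h4
  exact hqs ⟨t, by linarith⟩

theorem exists_absNorm_eq_prime_of_dvd_sub_sq {K : Type*} [Field K] [NumberField K]
    (hdeg : Module.finrank ℚ K = 2) (hneg : discr K < 0) {q : ℕ} (hq : q.Prime) (hq2 : q ≠ 2)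
    {s : ℤ} (hqD : ¬ (q : ℤ) ∣ discr K) (hs : (q : ℤ) ∣ discr K - s ^ 2) :
    ∃ I : Ideal (𝓞 K), Ideal.absNorm I = q := by
  have hqp : Prime (q : ℤ) := Nat.prime_iff_prime_int.1 hq
  obtain ⟨δ, hδ⟩ := exists_sq_eq_discr (K := K) hdeg
  obtain ⟨c, hc⟩ := hs
  have hc' : (discr K : 𝓞 K) - s ^ 2 = q * c := by
    exact_mod_cast congrArg (Int.cast : ℤ → 𝓞 K) hc
  have hqs : ¬ (q : ℤ) ∣ 2 * s := by
    intro h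
    rcases hqp.dvd_mul.1 h with h | h
    · exact hq2 ((Nat.prime_dvd_prime_iff_eq hq Nat.prime_two).1 (by exact_mod_cast h))
    · refine hqD ?_
      rw [show discr K = (discr K - s ^ 2) + s * s by ring, hc]
      exact dvd_add (dvd_mul_right _ _) (h.mul_left _)
  have hqs' : ¬ (q : ℤ) ∣ 2 * -s := by rwa [mul_neg, dvd_neg]
  obtain ⟨a, b, hab⟩ := (Prime.coprime_iff_not_dvd hqp).2 hqs
  have hab' : (a : 𝓞 K) * q + b * (2 * s) = 1 := by
    exact_mod_cast congrArg (Int.cast : ℤ → 𝓞 K) hab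
  obtain ⟨A, hA⟩ : ∃ A : Ideal (𝓞 K), A = Ideal.span {(q : 𝓞 K), δ + (-s : ℤ)} := ⟨_, rfl⟩
  obtain ⟨B, hB⟩ : ∃ B : Ideal (𝓞 K), B = Ideal.span {(q : 𝓞 K), δ + s} := ⟨_, rfl⟩
  have hqA : (q : 𝓞 K) ∈ A := hA ▸ Ideal.subset_span (by simp)
  have hqB : (q : 𝓞 K) ∈ B := hB ▸ Ideal.subset_span (by simp)
  have hdA : δ + (-s : ℤ) ∈ A := hA ▸ Ideal.subset_span (by simp)
  have hdB : δ + s ∈ B := hB ▸ Ideal.subset_span (by simp)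
  have hAB : A * B = Ideal.span {(q : 𝓞 K)} := by
    apply le_antisymm
    · rw [hA, hB, Ideal.span_pair_mul_span_pair, Ideal.span_le]
      intro x hx
      simp only [Set.mem_insert_iff, Set.mem_singleton_iff] at hx
      rw [SetLike.mem_coe, Ideal.mem_span_singleton]
      rcases hx with rfl | rfl | rfl | rfl
      · exact Dvd.intro _ rfl
      · exact Dvd.intro _ rfl
      · exact Dvd.intro_left _ rfl
      · exact ⟨c, by push_cast; linear_combination hδ + hc'⟩
    · rw [Ideal.span_singleton_le_iff_mem]
      have h1 := Ideal.mul_mem_mul hqA hqB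
      have h2 := Ideal.mul_mem_mul hqA hdB
      have h3 := Ideal.mul_mem_mul hdA hqB
      have h4 := add_mem (Ideal.mul_mem_left _ (a : 𝓞 K) h1)
        (Ideal.mul_mem_left _ (b : 𝓞 K) (sub_mem h2 h3))
      convert h4 using 1
      push_cast
      linear_combination (-(q : 𝓞 K)) * hab'
  have hnorm : Ideal.absNorm A * Ideal.absNorm B = q ^ 2 := by
    rw [← map_mul, hAB, absNorm_span_natCast_of_finrank_eq_two hdeg]
  have hA1 : Ideal.absNorm A ≠ 1 := by
    rw [Ne, Ideal.absNorm_eq_one_iff]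
    rintro h
    rw [h, Ideal.top_mul] at hAB
    rw [hAB, Ideal.mem_span_singleton] at hdB
    exact not_natCast_dvd_sqrt_discr_add hdeg hneg hδ hqs hdB
  have hB1 : Ideal.absNorm B ≠ 1 := by
    rw [Ne, Ideal.absNorm_eq_one_iff]
    rintro h
    rw [h, Ideal.mul_top] at hAB
    rw [hAB, Ideal.mem_span_singleton] at hdA
    exact not_natCast_dvd_sqrt_discr_add hdeg hneg hδ hqs' hdA
  exact ⟨A, ((Nat.Prime.mul_eq_prime_sq_iff hq hA1 hB1).1 hnorm).1⟩

theorem MulChar.natCast_ne_zero_of_coprime {N : ℕ} (ψ : MulChar (ZMod N) ℤ) {n : ℕ}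
    (hn : n.Coprime N) : ψ n ≠ 0 :=
  (((ZMod.isUnit_iff_coprime n N).2 hn).map ψ).ne_zero

theorem eq_sq_sub_of_sq_sub_eq {t y E : ℤ} {n : ℕ} (h : t ^ 2 - 4 * (n : ℤ) = 4 * E * y ^ 2) :
    ∃ t' : ℤ, (n : ℤ) = t' ^ 2 - E * y ^ 2 := by
  have : Even t := by
    have h2 : Even (t ^ 2) := ⟨2 * n + 2 * E * y ^ 2, by linarith⟩
    simpa [Int.even_pow] using h2
  obtain ⟨t', rfl⟩ := this
  exact ⟨t', by linarith⟩

theorem exists_local_mulChar {p : ℕ} (hp : p.Prime) {P : ℤ}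
    (hodd : p ≠ 2 → P = (-1) ^ ((p - 1) / 2) * (p : ℤ))
    (heven : p = 2 → P = -4 ∨ P = -8 ∨ P = 8) {D D' : ℤ} (hD : D = P * D')
    (hD' : p = 2 → D' % 4 = 1) :
    ∃ (e : ℕ) (ψ : MulChar (ZMod (p ^ e)) ℤ),
      (∀ q : ℕ, q.Prime → q ≠ p → ψ q = kroneckerAtPrime P q) ∧ (∃ a, ψ a = -1) ∧
      ∀ (t y : ℤ) (n : ℕ), t ^ 2 - 4 * (n : ℤ) = D * y ^ 2 → n.Coprime (p ^ e) → ψ n = 1 := by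
  rcases eq_or_ne p 2 with rfl | hp2
  · obtain ⟨d, hd⟩ : ∃ d, D' = 4 * d + 1 := ⟨D' / 4, by have := hD' rfl; omega⟩
    have hqodd : ∀ q : ℕ, q.Prime → q ≠ 2 → Odd q := fun q hq h => hq.odd_of_ne_two h
    have hsq4 : ∀ q : ℕ, Odd q → jacobiSym 4 q = 1 := by
      intro q hq
      rw [show (4 : ℤ) = 2 ^ 2 by norm_num]
      exact jacobiSym.sq_one' (by
        exact_mod_cast (Nat.coprime_two_left).2 hq)
    rcases heven rfl with rfl | rfl | rfl
    · refine ⟨2, ZMod.χ₄, fun q hq hq2 => ?_, ⟨3, by decide⟩, ?_⟩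
      · rw [kroneckerAtPrime, if_neg hq2, show (-4 : ℤ) = 4 * -1 by norm_num, jacobiSym.mul_left,
          hsq4 q (hqodd q hq hq2), one_mul, jacobiSym.at_neg_one (hqodd q hq hq2)]
      · intro t y n h hn
        obtain ⟨t', ht⟩ := eq_sq_sub_of_sq_sub_eq (E := -(4 * d + 1)) (n := n) (t := t) (y := y)
          (by rw [h, hD, hd]; ring)
        have h1 : (n : ZMod 4) = (t' : ZMod 4) ^ 2 + (y : ZMod 4) ^ 2 := by
          have h2 := congrArg (Int.cast : ℤ → ZMod 4) ht
          push_cast at h2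
          rw [h2]
          linear_combination ((d : ZMod 4) * (y : ZMod 4) ^ 2) * (by decide : (4 : ZMod 4) = 0)
        have h2 : ∀ a b : ZMod 4, ZMod.χ₄ (a ^ 2 + b ^ 2) = 0 ∨ ZMod.χ₄ (a ^ 2 + b ^ 2) = 1 :=
          by decide
        have h3 := MulChar.natCast_ne_zero_of_coprime ZMod.χ₄ hn
        rw [h1] at h3 ⊢
        exact (h2 _ _).resolve_left h3
    · refine ⟨3, ZMod.χ₈', fun q hq hq2 => ?_, ⟨5, by decide⟩, ?_⟩
      · rw [kroneckerAtPrime, if_neg hq2, show (-8 : ℤ) = 4 * -2 by norm_num, jacobiSym.mul_left,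
          hsq4 q (hqodd q hq hq2), one_mul, jacobiSym.at_neg_two (hqodd q hq hq2)]
      · intro t y n h hn
        obtain ⟨t', ht⟩ := eq_sq_sub_of_sq_sub_eq (E := -2 * (4 * d + 1)) (n := n) (t := t) (y := y)
          (by rw [h, hD, hd]; ring)
        have h1 : (n : ZMod 8) = (t' : ZMod 8) ^ 2 + 2 * (y : ZMod 8) ^ 2 := by
          have h2 := congrArg (Int.cast : ℤ → ZMod 8) ht
          push_cast at h2
          rw [h2]
          linear_combination ((d : ZMod 8) * (y : ZMod 8) ^ 2) * (by decide : (8 : ZMod 8) = 0)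
        have h2 : ∀ a b : ZMod 8, ZMod.χ₈' (a ^ 2 + 2 * b ^ 2) = 0 ∨ ZMod.χ₈' (a ^ 2 + 2 * b ^ 2) = 1 :=
          by decide
        have h3 := MulChar.natCast_ne_zero_of_coprime ZMod.χ₈' hn
        rw [h1] at h3 ⊢
        exact (h2 _ _).resolve_left h3
    · refine ⟨3, ZMod.χ₈, fun q hq hq2 => ?_, ⟨3, by decide⟩, ?_⟩
      · rw [kroneckerAtPrime, if_neg hq2, show (8 : ℤ) = 4 * 2 by norm_num, jacobiSym.mul_left,
          hsq4 q (hqodd q hq hq2), one_mul, jacobiSym.at_two (hqodd q hq hq2)]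
      · intro t y n h hn
        obtain ⟨t', ht⟩ := eq_sq_sub_of_sq_sub_eq (E := 2 * (4 * d + 1)) (n := n) (t := t) (y := y)
          (by rw [h, hD, hd]; ring)
        have h1 : (n : ZMod 8) = (t' : ZMod 8) ^ 2 - 2 * (y : ZMod 8) ^ 2 := by
          have h2 := congrArg (Int.cast : ℤ → ZMod 8) ht
          push_cast at h2
          rw [h2]
          linear_combination (-(d : ZMod 8) * (y : ZMod 8) ^ 2) * (by decide : (8 : ZMod 8) = 0)
        have h2 : ∀ a b : ZMod 8, ZMod.χ₈ (a ^ 2 - 2 * b ^ 2) = 0 ∨ ZMod.χ₈ (a ^ 2 - 2 * b ^ 2) = 1 :=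
          by decide
        have h3 := MulChar.natCast_ne_zero_of_coprime ZMod.χ₈ hn
        rw [h1] at h3 ⊢
        exact (h2 _ _).resolve_left h3
  · have : Fact p.Prime := ⟨hp⟩
    refine ⟨1, ?_⟩
    rw [pow_one]
    refine ⟨quadraticChar (ZMod p), ?_, quadraticChar_exists_neg_one
      (by rwa [ZMod.ringChar_zmod_n]), ?_⟩
    · intro q hq hqp
      have hleg : quadraticChar (ZMod p) (q : ZMod p) = jacobiSym q p := by
        rw [← jacobiSym.legendreSym.to_jacobiSym, legendreSym, Int.cast_natCast]
      have hdiv : (p - 1) / 2 = p / 2 := by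
        have := hp.odd_of_ne_two hp2
        obtain ⟨c, rfl⟩ := this
        omega
      rw [hleg, hodd hp2, hdiv, kroneckerAtPrime]
      have hpo := hp.odd_of_ne_two hp2
      by_cases h1 : q = 2
      · subst h1
        rw [if_pos rfl, Nat.cast_two, jacobiSym.at_two hpo, ZMod.χ₈_nat_eq_if_mod_eight]
        rcases Nat.even_or_odd (p / 2) with h2 | h2
        · rw [h2.neg_one_pow]
          obtain ⟨c, hc⟩ := h2
          split_ifs <;> omega
        · rw [h2.neg_one_pow]
          obtain ⟨c, hc⟩ := h2
          split_ifs <;> omega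
      · rw [if_neg h1]
        have hqo := hq.odd_of_ne_two h1
        rw [jacobiSym.mul_left, jacobiSym.pow_left, jacobiSym.at_neg_one hqo,
          jacobiSym.quadratic_reciprocity hqo hpo, ZMod.χ₄_eq_neg_one_pow (Nat.odd_iff.1 hqo),
          ← pow_mul, mul_comm (q / 2)]
    · intro t y n h hn
      have h1 : ((t : ZMod p)) ^ 2 = 2 ^ 2 * n := by
        have h2 := congrArg (Int.cast : ℤ → ZMod p) h
        push_cast at h2
        have hP : (P : ZMod p) = 0 := by rw [hodd hp2]; simp
        have hD0 : (D : ZMod p) = 0 := by rw [hD]; simp [hP]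
        rw [hD0] at h2
        linear_combination h2
      have h2 : (2 : ZMod p) ≠ 0 := by
        have h3 := (ZMod.natCast_eq_zero_iff 2 p).not.2 fun h3 =>
          hp2 ((Nat.prime_dvd_prime_iff_eq hp Nat.prime_two).1 h3)
        exact_mod_cast h3
      have hn0 : (n : ZMod p) ≠ 0 := by
        rw [Ne, ZMod.natCast_eq_zero_iff]
        intro h
        exact hp.one_lt.ne' (Nat.Coprime.eq_one_of_dvd hn.symm h)
      rw [quadraticChar_one_iff_isSquare hn0]
      exact ⟨t / 2, by field_simp; linear_combination -h1⟩

theorem exists_prime_gt_forall_natCast_eq {ι : Type*} [Fintype ι] (N : ι → ℕ)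
    (hN : ∀ i, N i ≠ 0) (hcop : Pairwise (Function.onFun Nat.Coprime N))
    (a : ∀ i, ZMod (N i)) (ha : ∀ i, IsUnit (a i)) (B : ℕ) :
    ∃ q > B, q.Prime ∧ ∀ i, (q : ZMod (N i)) = a i := by
  have : NeZero (∏ i, N i) := ⟨Finset.prod_ne_zero_iff.2 fun i _ => hN i⟩
  have hu : IsUnit ((ZMod.prodEquivPi N hcop).symm a) := (Pi.isUnit_iff.2 ha).map _
  obtain ⟨q, hqB, hq, hqa⟩ := Nat.forall_exists_prime_gt_and_eq_mod hu B
  refine ⟨q, hqB, hq, fun i => ?_⟩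
  have h := congrArg (ZMod.prodEquivPi N hcop) hqa
  rw [RingEquiv.apply_symm_apply, map_natCast] at h
  exact congrFun h i

theorem prod_kroneckerAtPrime {ι : Type*} (s : Finset ι) (f : ι → ℤ) {q : ℕ} (hq : q ≠ 2) :
    ∏ i ∈ s, kroneckerAtPrime (f i) q = jacobiSym (∏ i ∈ s, f i) q := by
  classical
  induction s using Finset.induction_on with
  | empty => simp
  | insert a s ha ih =>
    rw [Finset.prod_insert ha, Finset.prod_insert ha, jacobiSym.mul_left, ih, kroneckerAtPrime,
      if_neg hq]

theorem exists_dvd_sub_sq_of_jacobiSym_eq_one {q : ℕ} (hq : q.Prime) {D : ℤ}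
    (h : jacobiSym D q = 1) : ∃ s : ℤ, (q : ℤ) ∣ D - s ^ 2 := by
  have : Fact q.Prime := ⟨hq⟩
  have hD : (D : ZMod q) ≠ 0 := by
    intro h0
    rw [← jacobiSym.legendreSym.to_jacobiSym, (legendreSym.eq_zero_iff q D).2 h0] at h
    exact zero_ne_one h
  rw [← jacobiSym.legendreSym.to_jacobiSym, legendreSym.eq_one_iff q hD] at h
  obtain ⟨r, hr⟩ := h
  obtain ⟨s, rfl⟩ := ZMod.intCast_surjective r
  exact ⟨s, (ZMod.intCast_eq_intCast_iff_dvd_sub _ _ _).1 (by push_cast; rw [hr, sq])⟩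

theorem exists_nonZeroDivisors_absNorm_eq {K : Type*} [Field K] [NumberField K]
    (hdeg : Module.finrank ℚ K = 2) (hneg : discr K < 0) {q : ℕ} (hq : q.Prime) (hq2 : q ≠ 2)
    (hqD : (discr K).natAbs < q) (hj : jacobiSym (discr K) q = 1) :
    ∃ I : nonZeroDivisors (Ideal (𝓞 K)), Ideal.absNorm (I : Ideal (𝓞 K)) = q := by
  obtain ⟨s, hs⟩ := exists_dvd_sub_sq_of_jacobiSym_eq_one hq hj
  obtain ⟨I, hI⟩ := exists_absNorm_eq_prime_of_dvd_sub_sq hdeg hneg hq hq2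
    (fun h => absurd (Nat.le_of_dvd (by omega) (Int.natCast_dvd.1 h)) (by omega)) hs
  refine ⟨⟨I, mem_nonZeroDivisors_of_ne_zero ?_⟩, hI⟩
  rintro rfl
  exact hq.ne_zero (by simpa using hI.symm)

theorem pow_val_add_of_sq_eq_one {G : Type*} [Monoid G] {g : G} (hg : g ^ 2 = 1) (a b : ZMod 2) :
    g ^ (a + b).val = g ^ a.val * g ^ b.val := by
  rw [← pow_add, ZMod.val_add, ← pow_mod_orderOf g ((a.val + b.val) % 2),
    ← pow_mod_orderOf g (a.val + b.val), Nat.mod_mod_of_dvd _ (orderOf_dvd_of_pow_eq_one hg)]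

/-- The homomorphism `x ↦ ∏ i, g i ^ x i` from an `𝔽₂`-vector space attached to a family `g` of
elements of exponent two. -/
def prodPowHom {ι G : Type*} [Fintype ι] [CommGroup G] (g : ι → G) (hg : ∀ i, g i ^ 2 = 1) :
    Multiplicative (ι → ZMod 2) →* G where
  toFun x := ∏ i, g i ^ (x.toAdd i).val
  map_one' := by simp
  map_mul' x y := by
    simp only [toAdd_mul, Pi.add_apply, pow_val_add_of_sq_eq_one (hg _), Finset.prod_mul_distrib]

theorem prodPowHom_ofAdd {ι G : Type*} [Fintype ι] [CommGroup G] (g : ι → G)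
    (hg : ∀ i, g i ^ 2 = 1) (x : ι → ZMod 2) :
    prodPowHom g hg (Multiplicative.ofAdd x) = ∏ i, g i ^ (x i).val := rfl

theorem range_prodPowHom {ι G : Type*} [Fintype ι] [CommGroup G] (g : ι → G)
    (hg : ∀ i, g i ^ 2 = 1) (hgen : ∀ c : G, c ^ 2 = 1 → c ∈ Subgroup.closure (Set.range g)) :
    (prodPowHom g hg).range = (powMonoidHom 2 : G →* G).ker := by
  classical
  apply le_antisymm
  · rintro _ ⟨x, rfl⟩
    rw [MonoidHom.mem_ker, powMonoidHom_apply, ← map_pow]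
    have : x ^ 2 = 1 := by
      rw [← toAdd_eq_zero, toAdd_pow]
      exact funext fun i => CharTwo.two_nsmul (x.toAdd i)
    rw [this, map_one]
  · intro c hc
    refine (Subgroup.closure_le _).2 ?_ (hgen c hc)
    rintro _ ⟨i, rfl⟩
    refine ⟨Multiplicative.ofAdd (Pi.single i 1), ?_⟩
    rw [prodPowHom_ofAdd, Finset.prod_eq_single i]
    · simp [ZMod.val_one]
    · intro j _ hj
      simp [hj]
    · simp

theorem prodPowHom_ker_ne_bot {ι G : Type*} [Fintype ι] [CommGroup G] (g : ι → G)
    (hg : ∀ i, g i ^ 2 = 1) {S : Finset ι} (hS : S.Nonempty) (hprod : ∏ i ∈ S, g i = 1) :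
    (prodPowHom g hg).ker ≠ ⊥ := by
  classical
  obtain ⟨i, hi⟩ := hS
  intro h
  have h1 : Multiplicative.ofAdd (fun j => if j ∈ S then (1 : ZMod 2) else 0) ∈
      (prodPowHom g hg).ker := by
    rw [MonoidHom.mem_ker, prodPowHom_ofAdd, ← hprod, ← Finset.prod_filter_mul_prod_filter_not
      Finset.univ (· ∈ S)]
    rw [Finset.prod_congr rfl (g := g) (by intro x hx; simp_all [ZMod.val_one]),
      Finset.prod_eq_one (s := Finset.univ.filter (· ∉ S)) (by intro x hx; simp_all), mul_one]
    simp
  rw [h, Subgroup.mem_bot, ofAdd_eq_one] at h1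
  simpa [hi] using congrFun h1 i

/-- The sign `(-1) ^ a` of an element `a` of `𝔽₂`. -/
def zmodTwoSign (a : ZMod 2) : ℤˣ := (-1) ^ a.val

theorem zmodTwoSign_eq_one_iff : ∀ a : ZMod 2, zmodTwoSign a = 1 ↔ a = 0 := by decide

theorem zmodTwoSign_add : ∀ a b : ZMod 2, zmodTwoSign (a + b) = zmodTwoSign a * zmodTwoSign b := by
  decide

theorem zmodTwoSign_mul : ∀ a b : ZMod 2, zmodTwoSign (a * b) = zmodTwoSign a ^ b.val := by
  decide

theorem zmodTwoSign_sum {ι : Type*} (s : Finset ι) (f : ι → ZMod 2) :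
    zmodTwoSign (∑ i ∈ s, f i) = ∏ i ∈ s, zmodTwoSign (f i) := by
  classical
  induction s using Finset.induction_on with
  | empty => rfl
  | insert a s ha ih => rw [Finset.sum_insert ha, Finset.prod_insert ha, zmodTwoSign_add, ih]

theorem Subgroup.card_map_mul_card_ker_inf {G H : Type*} [Group G] [Group H] (f : G →* H)
    (L : Subgroup G) : Nat.card (L.map f) * Nat.card (f.ker ⊓ L : Subgroup G) = Nat.card L := by
  rw [← Subgroup.relIndex_ker, ← Subgroup.inf_relIndex_right, mul_comm,
    ← Subgroup.relIndex_bot_left, ← Subgroup.relIndex_bot_left,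
    Subgroup.relIndex_mul_relIndex _ _ _ bot_le inf_le_right]

theorem Subgroup.card_range_pow_two_quotient {G : Type*} [CommGroup G] [Finite G] :
    Nat.card ((powMonoidHom 2 : G →* G).range ⧸
      ((powMonoidHom 4 : G →* G).range.subgroupOf (powMonoidHom 2 : G →* G).range)) =
      Nat.card ((powMonoidHom 2 : G →* G).ker ⊓ (powMonoidHom 2 : G →* G).range : Subgroup G) := by
  have h4 : (powMonoidHom 4 : G →* G).range =
      (powMonoidHom 2 : G →* G).range.map (powMonoidHom 2) := by
    rw [MonoidHom.map_range]
    congr 1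
    ext x
    simp [← pow_mul]
  have h1 := Subgroup.card_map_mul_card_ker_inf (powMonoidHom 2 : G →* G)
    (powMonoidHom 2 : G →* G).range
  have hle : (powMonoidHom 4 : G →* G).range ≤ (powMonoidHom 2 : G →* G).range := by
    rintro _ ⟨x, rfl⟩
    exact ⟨x ^ 2, by simp [← pow_mul]⟩
  have h2 := Subgroup.relIndex_mul_relIndex ⊥ _ _ bot_le hle
  rw [Subgroup.relIndex_bot_left, Subgroup.relIndex_bot_left] at h2
  rw [← h4, ← h2] at h1
  exact (Nat.eq_of_mul_eq_mul_left Nat.card_pos h1).symm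

theorem Matrix.card_ker_vecMul {k : ℕ} (M : Matrix (Fin k) (Fin k) (ZMod 2)) :
    Nat.card {x : Fin k → ZMod 2 // Matrix.vecMul x M = 0} = 2 ^ (k - M.rank) := by
  have h1 := LinearMap.finrank_range_add_finrank_ker M.transpose.mulVecLin
  rw [← Matrix.rank, Matrix.rank_transpose, Module.finrank_fin_fun] at h1
  have h2 := Module.natCard_eq_pow_finrank (K := ZMod 2) (V := LinearMap.ker M.transpose.mulVecLin)
  rw [Nat.card_zmod, show Module.finrank (ZMod 2) (LinearMap.ker M.transpose.mulVecLin) =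
    k - M.rank by omega] at h2
  rw [← h2]
  refine Nat.card_congr (Equiv.subtypeEquivRight fun x => ?_)
  rw [LinearMap.mem_ker, Matrix.mulVecLin_apply, Matrix.mulVec_transpose]

theorem card_ker_prod_signs {k : ℕ} (hk : 1 ≤ k) :
    2 * Nat.card (MonoidHom.ker (∏ i, Pi.evalMonoidHom (fun _ : Fin k => ℤˣ) i)) = 2 ^ k := by
  classical
  have h1 := Subgroup.card_mul_index (MonoidHom.ker (∏ i, Pi.evalMonoidHom (fun _ : Fin k => ℤˣ) i))
  have h2 : (∏ i, Pi.evalMonoidHom (fun _ : Fin k => ℤˣ) i).range = ⊤ := by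
    rw [MonoidHom.range_eq_top]
    intro ε
    refine ⟨Pi.mulSingle ⟨0, hk⟩ ε, ?_⟩
    rw [MonoidHom.finsetProd_apply]
    simp [Pi.mulSingle_apply]
  rw [Subgroup.index_ker, h2] at h1
  rw [mul_comm]
  simpa using h1

theorem card_range_pow_two_quotient_eq {G : Type*} [CommGroup G] [Finite G] {k : ℕ} (hk : 1 ≤ k)
    (M : Matrix (Fin k) (Fin k) (ZMod 2)) (hrow : ∀ i, ∑ j, M i j = 0)
    (g : Fin k → G) (hg : ∀ i, g i ^ 2 = 1)
    (hgen : ∀ c : G, c ^ 2 = 1 → c ∈ Subgroup.closure (Set.range g))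
    {S : Finset (Fin k)} (hS : S.Nonempty) (hprod : ∏ i ∈ S, g i = 1)
    (χ : Fin k → G →* ℤˣ) (hχ : ∀ ε : Fin k → ℤˣ, ∏ i, ε i = 1 → ∃ c, ∀ j, χ j c = ε j)
    (hM : ∀ i j, i ≠ j → χ j (g i) = zmodTwoSign (M i j)) :
    Nat.card ((powMonoidHom 2 : G →* G).range ⧸
      ((powMonoidHom 4 : G →* G).range.subgroupOf (powMonoidHom 2 : G →* G).range)) =
      2 ^ (k - 1 - M.rank) := by
  classical
  rw [Subgroup.card_range_pow_two_quotient]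
  obtain ⟨φ, hφ⟩ : ∃ φ, φ = prodPowHom g hg := ⟨_, rfl⟩
  obtain ⟨X, hX⟩ : ∃ X : G →* (Fin k → ℤˣ), X = MonoidHom.pi χ := ⟨_, rfl⟩
  have hXa : ∀ c j, X c j = χ j c := fun c j => by rw [hX]; rfl
  have hφr : φ.range = (powMonoidHom 2 : G →* G).ker := hφ ▸ range_prodPowHom g hg hgen
  have hker2 : 2 ≤ Nat.card φ.ker := by
    have := hφ ▸ prodPowHom_ker_ne_bot g hg hS hprod
    exact (Subgroup.one_lt_card_iff_ne_bot _).2 this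
  have hT : Nat.card φ.ker * Nat.card (powMonoidHom 2 : G →* G).ker = 2 ^ k := by
    rw [← hφr, ← Subgroup.index_ker, Subgroup.card_mul_index]
    simp
  have hTi : Nat.card (powMonoidHom 2 : G →* G).ker = (powMonoidHom 2 : G →* G).range.index := by
    have h1 := (powMonoidHom 2 : G →* G).ker.card_mul_index
    rw [Subgroup.index_ker, ← (powMonoidHom 2 : G →* G).range.card_mul_index, mul_comm] at h1
    exact Nat.eq_of_mul_eq_mul_left Nat.card_pos h1
  obtain ⟨H, hH⟩ : ∃ H, H = MonoidHom.ker (∏ i, Pi.evalMonoidHom (fun _ : Fin k => ℤˣ) i) :=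
    ⟨_, rfl⟩
  have hHc : 2 * Nat.card H = 2 ^ k := hH ▸ card_ker_prod_signs hk
  have hmemH : ∀ ε, ε ∈ H ↔ ∏ i, ε i = 1 := fun ε => by
    rw [hH, MonoidHom.mem_ker, MonoidHom.finsetProd_apply]; rfl
  have hHX : H ≤ X.range := by
    intro ε hε
    obtain ⟨c, hc⟩ := hχ ε ((hmemH ε).1 hε)
    exact ⟨c, funext fun j => by rw [hXa, hc]⟩
  have hsqX : (powMonoidHom 2 : G →* G).range ≤ X.ker := by
    rintro _ ⟨c, rfl⟩
    rw [MonoidHom.mem_ker, powMonoidHom_apply, map_pow]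
    exact funext fun j => by rw [Pi.pow_apply, Int.units_sq]; rfl
  have hrel := Subgroup.relIndex_mul_index hsqX
  rw [Subgroup.index_ker, ← hTi] at hrel
  have hHXc : Nat.card H ≤ Nat.card X.range := Subgroup.card_le_of_le hHX
  have hrel0 : (powMonoidHom 2 : G →* G).range.relIndex X.ker ≠ 0 := by
    intro h
    rw [h, zero_mul] at hrel
    exact Nat.card_pos.ne hrel
  have hXT : Nat.card X.range ≤ Nat.card (powMonoidHom 2 : G →* G).ker := by
    rw [← hrel]
    exact Nat.le_mul_of_pos_left _ (Nat.pos_of_ne_zero hrel0)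
  have hTH : Nat.card (powMonoidHom 2 : G →* G).ker ≤ Nat.card H := by
    nlinarith
  have hXH : Nat.card X.range = Nat.card H := by omega
  have hTX : Nat.card (powMonoidHom 2 : G →* G).ker = Nat.card X.range := by omega
  have hkφ : Nat.card φ.ker = 2 := by
    rw [hTX, hXH, ← hHc] at hT
    exact Nat.eq_of_mul_eq_mul_right Nat.card_pos hT
  have hXr : X.range = H := (Subgroup.eq_of_le_of_card_ge hHX hXH.le).symm
  have hXk : X.ker = (powMonoidHom 2 : G →* G).range := by
    refine le_antisymm (Subgroup.relIndex_eq_one.1 ?_) hsqX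
    rw [hTX] at hrel
    exact Nat.eq_of_mul_eq_mul_right Nat.card_pos (hrel.trans (one_mul _).symm)
  have hM' : ∀ i j, χ j (g i) = zmodTwoSign (M i j) := by
    intro i j
    rcases eq_or_ne i j with rfl | hij
    · have h1 : ∏ j, χ j (g i) = ∏ j, zmodTwoSign (M i j) := by
        rw [← zmodTwoSign_sum, hrow, (zmodTwoSign_eq_one_iff 0).2 rfl]
        have h2 := (hmemH (X (g i))).1 (hXr ▸ ⟨g i, rfl⟩)
        simpa only [hXa] using h2
      rw [← Finset.mul_prod_erase _ _ (Finset.mem_univ i),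
        ← Finset.mul_prod_erase _ _ (Finset.mem_univ i),
        Finset.prod_congr rfl fun j hj => hM i j (Finset.ne_of_mem_erase hj).symm] at h1
      exact mul_right_cancel h1
    · exact hM i j hij
  have hcomp : ∀ x, X (φ (Multiplicative.ofAdd x)) = 1 ↔ Matrix.vecMul x M = 0 := by
    intro x
    rw [funext_iff, funext_iff]
    refine forall_congr' fun j => ?_
    rw [hXa, hφ, prodPowHom_ofAdd, map_prod, Pi.one_apply, Pi.zero_apply,
      ← zmodTwoSign_eq_one_iff, Matrix.vecMul, dotProduct, zmodTwoSign_sum]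
    simp only [map_pow, hM', mul_comm (x _), zmodTwoSign_mul]
  have hL : Nat.card (X.comp φ).ker = 2 ^ (k - M.rank) := by
    rw [← Matrix.card_ker_vecMul]
    exact Nat.card_congr (Equiv.subtypeEquiv Multiplicative.toAdd fun x => hcomp x.toAdd)
  have hmap : (X.comp φ).ker.map φ =
      ((powMonoidHom 2 : G →* G).ker ⊓ (powMonoidHom 2 : G →* G).range : Subgroup G) := by
    rw [← hXk, ← hφr, ← MonoidHom.comap_ker, Subgroup.map_comap_eq]
  have hfin := Subgroup.card_map_mul_card_ker_inf φ (X.comp φ).ker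
  have hle : φ.ker ≤ (X.comp φ).ker := fun x hx => by
    rw [MonoidHom.mem_ker, MonoidHom.comp_apply, (MonoidHom.mem_ker).1 hx, map_one]
  rw [inf_eq_left.2 hle, hkφ, hL, hmap] at hfin
  have hpos : k - M.rank ≠ 0 := by
    intro h
    rw [h] at hfin
    omega
  rw [show k - M.rank = (k - 1 - M.rank) + 1 by omega, pow_succ] at hfin
  exact Nat.eq_of_mul_eq_mul_right two_pos hfin

theorem dvd_primeDiscriminant {p : ℕ} {P : ℤ}
    (hodd : p ≠ 2 → P = (-1) ^ ((p - 1) / 2) * (p : ℤ))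
    (heven : p = 2 → P = -4 ∨ P = -8 ∨ P = 8) : (p : ℤ) ∣ P := by
  rcases eq_or_ne p 2 with rfl | hp2
  · rcases heven rfl with rfl | rfl | rfl <;> norm_num
  · exact hodd hp2 ▸ dvd_mul_left _ _

theorem eq_of_dvd_primeDiscriminant {p : ℕ} (hp : p.Prime) {P : ℤ}
    (hodd : p ≠ 2 → P = (-1) ^ ((p - 1) / 2) * (p : ℤ))
    (heven : p = 2 → P = -4 ∨ P = -8 ∨ P = 8) {q : ℕ} (hq : q.Prime) (h : (q : ℤ) ∣ P) :
    p = q := by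
  rw [Int.natCast_dvd] at h
  rcases eq_or_ne p 2 with rfl | hp2
  · have h8 : q ∣ 2 ^ 3 := h.trans (by rcases heven rfl with rfl | rfl | rfl <;> decide)
    exact ((Nat.prime_dvd_prime_iff_eq hq hp).1 (hq.dvd_of_dvd_pow h8)).symm
  · rw [hodd hp2, Int.natAbs_mul, Int.natAbs_pow, Int.natAbs_neg, Int.natAbs_one, one_pow, one_mul,
      Int.natAbs_natCast] at h
    exact ((Nat.prime_dvd_prime_iff_eq hq hp).1 h).symm

theorem primeDiscriminant_emod_four {p : ℕ} (hp : p.Prime) (hp2 : p ≠ 2) {P : ℤ}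
    (hodd : P = (-1) ^ ((p - 1) / 2) * (p : ℤ)) : P % 4 = 1 := by
  obtain ⟨c, hc⟩ := hp.odd_of_ne_two hp2
  have h1 : (p - 1) / 2 = c := by omega
  rw [h1] at hodd
  rcases Nat.even_or_odd c with h | h <;> rw [h.neg_one_pow] at hodd <;> obtain ⟨d, hd⟩ := h <;>
    omega

theorem Int.prod_emod_four_eq_one {ι : Type*} (s : Finset ι) (f : ι → ℤ)
    (h : ∀ i ∈ s, f i % 4 = 1) : (∏ i ∈ s, f i) % 4 = 1 := by
  rw [Finset.prod_int_mod, Finset.prod_eq_one h]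
  rfl

theorem sum_redeiMatrix_row {k : ℕ} (p : Fin k → ℕ) (pstar : Fin k → ℤ) (i : Fin k) :
    ∑ j, redeiMatrix p pstar i j = 0 := by
  rw [← Finset.add_sum_erase _ _ (Finset.mem_univ i)]
  have h : ∑ j ∈ Finset.univ.erase i, redeiMatrix p pstar i j = redeiMatrix p pstar i i := by
    simp only [redeiMatrix, Matrix.of_apply, if_true]
    exact Finset.sum_congr rfl fun j hj => if_neg (Finset.ne_of_mem_erase hj).symm
  rw [h, CharTwo.add_self_eq_zero]

theorem eq_zmodTwoSign_redeiMatrix {k : ℕ} (p : Fin k → ℕ) (pstar : Fin k → ℤ) {i j : Fin k}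
    (hij : i ≠ j) {u : ℤˣ} (hu : (u : ℤ) = kroneckerAtPrime (pstar j) (p i)) :
    u = zmodTwoSign (redeiMatrix p pstar i j) := by
  rw [redeiMatrix, Matrix.of_apply, if_neg hij, ← hu]
  rcases Int.units_eq_one_or u with rfl | rfl <;> decide

/-- (Rédei) Let `D = p_1^*⋯p_k^* < 0` be a fundamental discriminant written as a product of
prime fundamental discriminants attached to the distinct primes `p_1 < ⋯ < p_k` dividing `D`,
and let `M` be the Rédei matrix of `D`. Then the 4-rank of `Cl(D)` equals
`k − 1 − rank_{F_2}(M)`; i.e. `Cl(D)²/Cl(D)⁴` has order `2^{k − 1 − rank M}`. -/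
theorem redei_four_rank
    (k : ℕ) (hk : 1 ≤ k) (p : Fin k → ℕ) (hp : ∀ i, (p i).Prime) (hmono : StrictMono p)
    (pstar : Fin k → ℤ)
    (hodd : ∀ i, p i ≠ 2 → pstar i = (-1) ^ ((p i - 1) / 2) * (p i : ℤ))
    (heven : ∀ i, p i = 2 → pstar i = -4 ∨ pstar i = -8 ∨ pstar i = 8)
    (D : ℤ) (hD : D = ∏ i, pstar i) (hneg : D < 0) (hfund : IsFundamentalDiscriminant D)
    (K : Type) [Field K] [NumberField K]
    (hdeg : Module.finrank ℚ K = 2) (hdisc : NumberField.discr K = D) :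
    Nat.card
        ((powMonoidHom 2 : ClassGroup (𝓞 K) →* ClassGroup (𝓞 K)).range ⧸
          ((powMonoidHom 4 : ClassGroup (𝓞 K) →* ClassGroup (𝓞 K)).range.subgroupOf
            (powMonoidHom 2 : ClassGroup (𝓞 K) →* ClassGroup (𝓞 K)).range))
      = 2 ^ (k - 1 - (redeiMatrix p pstar).rank) := by
  subst hdisc
  have hpD : ∀ i, (p i : ℤ) ∣ discr K := fun i =>
    hD ▸ (dvd_primeDiscriminant (hodd i) (heven i)).trans (Finset.dvd_prod_of_mem _ (by simp))
  have hple : ∀ i, p i ≤ (discr K).natAbs := fun i =>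
    Nat.le_of_dvd (by omega) (Int.natCast_dvd.1 (hpD i))
  have hDp : ∀ q : ℕ, q.Prime → (q : ℤ) ∣ discr K → ∃ i, p i = q := by
    intro q hq hqD
    rw [hD] at hqD
    obtain ⟨i, -, hi⟩ := (Nat.prime_iff_prime_int.1 hq).exists_mem_finset_dvd hqD
    exact ⟨i, eq_of_dvd_primeDiscriminant (hp i) (hodd i) (heven i) hq hi⟩
  have hideal : ∀ i, ∃ I : nonZeroDivisors (Ideal (𝓞 K)),
      (I : Ideal (𝓞 K)) ^ 2 = Ideal.span {(p i : 𝓞 K)} := by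
    intro i
    obtain ⟨I, hI⟩ := exists_ideal_sq_eq_span_prime hdeg hfund (hp i) (hpD i)
    refine ⟨⟨I, mem_nonZeroDivisors_of_ne_zero ?_⟩, hI⟩
    rintro rfl
    have h := absNorm_span_natCast_of_finrank_eq_two hdeg (p i)
    rw [← hI] at h
    exact pow_ne_zero 2 (hp i).ne_zero (by simpa using h.symm)
  choose P hP using hideal
  have hPn : ∀ i, Ideal.absNorm (P i : Ideal (𝓞 K)) = p i := fun i => by
    have h := absNorm_span_natCast_of_finrank_eq_two hdeg (p i)
    rw [← hP, map_pow] at h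
    exact Nat.pow_left_injective two_ne_zero h
  have hP1 : ∀ i, ClassGroup.mk0 (P i) ^ 2 = 1 := fun i => by
    rw [← map_pow, ClassGroup.mk0_eq_one_iff]
    exact ⟨p i, by rw [SubmonoidClass.coe_pow, hP]⟩
  obtain ⟨S, hS, hprod⟩ :=
    exists_prod_mk0_eq_one hdeg hneg hfund p hp hmono.injective hDp P hP
  have hlocal := fun j => exists_local_mulChar (hp j) (hodd j) (heven j)
    (hD.trans (Finset.mul_prod_erase _ _ (Finset.mem_univ j)).symm) fun hj =>
      Int.prod_emod_four_eq_one _ _ fun i hi =>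
        have h2 : p i ≠ 2 := fun h => Finset.ne_of_mem_erase hi (hmono.injective (h.trans hj.symm))
        primeDiscriminant_emod_four (hp i) h2 (hodd i h2)
  choose e ψ hψkron hψneg hψnorm using hlocal
  have hN : ∀ j, p j ^ e j ≠ 0 := fun j => pow_ne_zero _ (hp j).ne_zero
  have hchar := fun j => exists_classGroup_hom_of_mulChar (K := K) (hN j) (ψ j) fun α hα => by
    obtain ⟨t, y, n, -, h, hn⟩ := exists_trace_norm_nonneg hdeg hneg α
    rw [hn] at hα ⊢
    exact hψnorm j t y n h hα
  choose X hX using hchar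
  have hXprime : ∀ (I : nonZeroDivisors (Ideal (𝓞 K))) (q : ℕ) (j : Fin k), q.Prime → q ≠ p j →
      Ideal.absNorm (I : Ideal (𝓞 K)) = q →
      (X j (ClassGroup.mk0 I) : ℤ) = kroneckerAtPrime (pstar j) q := by
    intro I q j hq hqj hI
    rw [hX j I (hI ▸ ((Nat.coprime_primes hq (hp j)).2 hqj).pow_right _), hI, hψkron j q hq hqj]
  refine card_range_pow_two_quotient_eq hk _ (sum_redeiMatrix_row p pstar)
    (fun i => ClassGroup.mk0 (P i)) hP1
    (fun c hc => mem_closure_of_sq_eq_one hdeg hneg hfund p hDp P hP c hc) hS hprod X ?_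
    fun i j hij => eq_zmodTwoSign_redeiMatrix p pstar hij
      (hXprime _ _ j (hp i) (hmono.injective.ne hij) (hPn i))
  intro ε hε
  have hunit : ∀ j, ∃ a, ψ j a = ε j ∧ IsUnit a := by
    intro j
    rcases Int.units_eq_one_or (ε j) with h | h
    · exact ⟨1, by simp [h], isUnit_one⟩
    · obtain ⟨a, ha⟩ := hψneg j
      refine ⟨a, by simp [h, ha], ?_⟩
      by_contra hu
      rw [MulChar.map_nonunit _ hu] at ha
      norm_num at ha
  choose a ha hau using hunit
  obtain ⟨q, hqB, hq, hqa⟩ := exists_prime_gt_forall_natCast_eq (fun j => p j ^ e j) hN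
    (fun i j hij => Nat.Coprime.pow _ _
      ((Nat.coprime_primes (hp i) (hp j)).2 (hmono.injective.ne hij))) a hau
    ((discr K).natAbs + 2)
  have hqp : ∀ j, q ≠ p j := fun j => by have := hple j; omega
  have hkron : ∀ j, kroneckerAtPrime (pstar j) q = ε j := fun j => by
    rw [← hψkron j q hq (hqp j), hqa, ha]
  have hjac : jacobiSym (discr K) q = 1 := by
    rw [hD, ← prod_kroneckerAtPrime _ _ (by omega : q ≠ 2),
      Finset.prod_congr rfl fun j _ => hkron j]
    rw [← Units.coe_prod, hε, Units.val_one]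
  obtain ⟨I, hI⟩ := exists_nonZeroDivisors_absNorm_eq hdeg hneg hq (by omega) (by omega) hjac
  exact ⟨ClassGroup.mk0 I, fun j => Units.ext ((hXprime I q j hq (hqp j) hI).trans (hkron j))⟩
end

section
/- Let D = p_1*⋯p_k* < 0 be a fundamental discriminant written as a product of k prime fundamental discriminants with p_1 < ⋯ < p_k, and assume p_1* ≠ −4 (i.e., D is odd or 8 divides D). Then the sum of the rows of the Rédei matrix M of D is the zero vector in F_2^k. -/
/-- The exponent `c ∈ F_2` with `(-1)^c = (a/q)`. -/
def kroneckerBit (a : ℤ) (q : ℕ) : ZMod 2 :=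
  if kroneckerAtPrime a q = 1 then 0 else 1

/-- The exponent `s ∈ F_2` with `(-1)^s` the sign of `a ≠ 0`. -/
def signBit (a : ℤ) : ZMod 2 := if a < 0 then 1 else 0

theorem signBit_mul {a b : ℤ} (ha : a ≠ 0) (hb : b ≠ 0) :
    signBit (a * b) = signBit a + signBit b := by
  unfold signBit
  rcases lt_or_gt_of_ne ha with h | h <;> rcases lt_or_gt_of_ne hb with h' | h'
  · simp only [h, h', (mul_pos_of_neg_of_neg h h').not_gt, if_true, if_false]; decide
  · simp [h, h'.not_gt, mul_neg_of_neg_of_pos h h']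
  · simp [h.not_gt, h', mul_neg_of_pos_of_neg h h']
  · simp [h.not_gt, h'.not_gt, (mul_pos h h').not_gt]

theorem signBit_prod {ι : Type*} (s : Finset ι) (f : ι → ℤ) (hf : ∀ i ∈ s, f i ≠ 0) :
    signBit (∏ i ∈ s, f i) = ∑ i ∈ s, signBit (f i) := by
  classical
  induction s using Finset.induction_on with
  | empty => simp [signBit]
  | insert a s ha ih =>
    simp only [Finset.mem_insert, forall_eq_or_imp] at hf
    rw [Finset.prod_insert ha, Finset.sum_insert ha,
      signBit_mul hf.1 (Finset.prod_ne_zero_iff.2 hf.2), ih hf.2]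

theorem neg_one_pow_mul_eq {p : ℕ} {a : ℤ} (h : a = (-1) ^ ((p - 1) / 2) * (p : ℤ))
    (hp : p % 2 = 1) : (p % 4 = 1 ∧ a = p) ∨ (p % 4 = 3 ∧ a = -p) := by
  have h' : p % 4 = 1 ∨ p % 4 = 3 := by omega
  rcases h' with h1 | h1
  · have : Even ((p - 1) / 2) := by rw [Nat.even_iff]; omega
    exact Or.inl ⟨h1, by rw [h, this.neg_one_pow, one_mul]⟩
  · have : Odd ((p - 1) / 2) := by rw [Nat.odd_iff]; omega
    exact Or.inr ⟨h1, by rw [h, this.neg_one_pow, neg_one_mul]⟩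

/-- Quadratic reciprocity for the prime discriminants attached to two odd primes. -/
theorem kroneckerBit_add_of_odd {p q : ℕ} {a b : ℤ} (hp : p.Prime) (hq : q.Prime)
    (hp2 : p ≠ 2) (hq2 : q ≠ 2) (hpq : p ≠ q)
    (ha : a = (-1) ^ ((p - 1) / 2) * (p : ℤ)) (hb : b = (-1) ^ ((q - 1) / 2) * (q : ℤ)) :
    kroneckerBit b p + kroneckerBit a q = signBit a * signBit b := by
  have hpo := hp.eq_two_or_odd.resolve_left hp2
  have hqo := hq.eq_two_or_odd.resolve_left hq2
  have hpO := Nat.odd_iff.2 hpo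
  have hqO := Nat.odd_iff.2 hqo
  have hp0 : (0 : ℤ) < p := by exact_mod_cast hp.pos
  have hq0 : (0 : ℤ) < q := by exact_mod_cast hq.pos
  have hcop : Int.gcd (q : ℤ) (p : ℤ) = 1 := by
    rw [Int.gcd_natCast_natCast]
    exact (Nat.coprime_primes hq hp).2 hpq.symm
  have key := jacobiSym.eq_one_or_neg_one hcop
  simp only [kroneckerBit, kroneckerAtPrime, hp2, hq2, if_false, signBit]
  rcases neg_one_pow_mul_eq ha hpo with ⟨hp4, rfl⟩ | ⟨hp4, rfl⟩ <;>
  rcases neg_one_pow_mul_eq hb hqo with ⟨hq4, rfl⟩ | ⟨hq4, rfl⟩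
  · rw [jacobiSym.quadratic_reciprocity_one_mod_four hp4 hqO]
    rcases key with h | h <;> simp [h, hp0.not_gt, hq0.not_gt, CharTwo.add_self_eq_zero]
  · rw [jacobiSym.quadratic_reciprocity_one_mod_four hp4 hqO, jacobiSym.neg _ hpO,
      ZMod.χ₄_nat_one_mod_four hp4]
    rcases key with h | h <;> simp [h, hp0.not_gt, CharTwo.add_self_eq_zero]
  · rw [jacobiSym.neg _ hqO, ZMod.χ₄_nat_one_mod_four hq4,
      jacobiSym.quadratic_reciprocity_one_mod_four hq4 hpO]
    rw [jacobiSym.quadratic_reciprocity_one_mod_four hq4 hpO] at key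
    rcases key with h | h <;> simp [h, hq0.not_gt, CharTwo.add_self_eq_zero]
  · rw [jacobiSym.neg _ hqO, jacobiSym.neg _ hpO, ZMod.χ₄_nat_three_mod_four hq4,
      ZMod.χ₄_nat_three_mod_four hp4, jacobiSym.quadratic_reciprocity_three_mod_four hp4 hq4]
    rcases key with h | h <;> simp [h, hp.pos, hq.pos]

/-- Quadratic reciprocity for an odd prime discriminant and `±8`. -/
theorem kroneckerBit_add_of_two {q : ℕ} {a b : ℤ} (hq : q.Prime) (hq2 : q ≠ 2)
    (ha : a = -8 ∨ a = 8) (hb : b = (-1) ^ ((q - 1) / 2) * (q : ℤ)) :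
    kroneckerBit b 2 + kroneckerBit a q = signBit a * signBit b := by
  have hqo := hq.eq_two_or_odd.resolve_left hq2
  have hqO := Nat.odd_iff.2 hqo
  have hq0 : (0 : ℤ) < q := by exact_mod_cast hq.pos
  have h8 : jacobiSym 8 q = if q % 8 = 1 ∨ q % 8 = 7 then 1 else -1 := by
    rw [show (8 : ℤ) = 2 ^ 3 by norm_num, jacobiSym.pow_left, jacobiSym.at_two hqO,
      ZMod.χ₈_nat_eq_if_mod_eight]
    simp only [hqo]
    split_ifs <;> simp_all
  have h8' : jacobiSym (-8) q = ZMod.χ₄ q * jacobiSym 8 q := jacobiSym.neg 8 hqO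
  simp only [kroneckerBit, kroneckerAtPrime, hq2, if_false, if_true, signBit]
  rcases neg_one_pow_mul_eq hb hqo with ⟨hq4, rfl⟩ | ⟨hq4, rfl⟩
  · rw [ZMod.χ₄_nat_one_mod_four hq4] at h8'
    obtain h | h : q % 8 = 1 ∨ q % 8 = 5 := by omega
    · have hz : (q : ℤ) % 8 = 1 := by omega
      rcases ha with rfl | rfl <;> simp [h8', h8, h, hz]
    · have hz : (q : ℤ) % 8 = 5 := by omega
      rcases ha with rfl | rfl <;> simp [h8', h8, h, hz, hq0.not_gt, CharTwo.add_self_eq_zero]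
  · rw [ZMod.χ₄_nat_three_mod_four hq4] at h8'
    obtain h | h : q % 8 = 3 ∨ q % 8 = 7 := by omega
    · have hz : -(q : ℤ) % 8 = 5 := by omega
      rcases ha with rfl | rfl <;> simp [h8', h8, h, hz, hq.pos, CharTwo.add_self_eq_zero]
    · have hz : -(q : ℤ) % 8 = 1 := by omega
      rcases ha with rfl | rfl <;> simp [h8', h8, h, hz, hq.pos]

/-- Each column sum of the Rédei matrix, in terms of the reciprocity defects. -/
theorem sum_redeiMatrix_col {k : ℕ} (p : Fin k → ℕ) (pstar : Fin k → ℤ) (j : Fin k) :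
    ∑ i, redeiMatrix p pstar i j =
      ∑ i ∈ Finset.univ.erase j,
        (kroneckerBit (pstar j) (p i) + kroneckerBit (pstar i) (p j)) := by
  rw [← Finset.sum_erase_add _ _ (Finset.mem_univ j), Finset.sum_add_distrib]
  congr 1
  · refine Finset.sum_congr rfl fun i hi => ?_
    simp [redeiMatrix, kroneckerBit, Finset.ne_of_mem_erase hi]
  · simp [redeiMatrix, kroneckerBit]

/-- Let `D = p_1^*⋯p_k^* < 0` be a fundamental discriminant written as a product of prime
fundamental discriminants attached to the distinct primes `p_1 < ⋯ < p_k` dividing `D`, and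
assume `p_1^* ≠ -4`. Then the sum of the rows of the Rédei matrix of `D` is the zero vector
in `F_2^k`. -/
theorem redei_row_sum_zero
    (k : ℕ) (hk : 0 < k) (p : Fin k → ℕ) (hp : ∀ i, (p i).Prime) (hmono : StrictMono p)
    (pstar : Fin k → ℤ)
    (hodd : ∀ i, p i ≠ 2 → pstar i = (-1) ^ ((p i - 1) / 2) * (p i : ℤ))
    (heven : ∀ i, p i = 2 → pstar i = -4 ∨ pstar i = -8 ∨ pstar i = 8)
    (D : ℤ) (hD : D = ∏ i, pstar i) (hneg : D < 0) (hfund : IsFundamentalDiscriminant D)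
    (h4 : pstar ⟨0, hk⟩ ≠ -4) :
    ∀ j, ∑ i, redeiMatrix p pstar i j = 0 := by
  intro j
  have h8 : ∀ i, p i = 2 → pstar i = -8 ∨ pstar i = 8 := by
    intro i hi
    have h0 : (⟨0, hk⟩ : Fin k) = i := by
      refine hmono.injective (le_antisymm (hmono.monotone (Nat.zero_le _)) ?_)
      rw [hi]
      exact (hp _).two_le
    exact (heven i hi).resolve_left (h0 ▸ h4)
  have hrec : ∀ i ∈ Finset.univ.erase j,
      kroneckerBit (pstar j) (p i) + kroneckerBit (pstar i) (p j) =
        signBit (pstar i) * signBit (pstar j) := by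
    intro i hi
    have hne : p i ≠ p j := hmono.injective.ne (Finset.ne_of_mem_erase hi)
    by_cases hi2 : p i = 2
    · have hj2 : p j ≠ 2 := fun h => hne (hi2.trans h.symm)
      rw [hi2]
      exact kroneckerBit_add_of_two (hp j) hj2 (h8 i hi2) (hodd j hj2)
    by_cases hj2 : p j = 2
    · rw [hj2, add_comm, mul_comm]
      exact kroneckerBit_add_of_two (hp i) hi2 (h8 j hj2) (hodd i hi2)
    · exact kroneckerBit_add_of_odd (hp i) (hp j) hi2 hj2 hne (hodd i hi2) (hodd j hj2)
  have hsum : ∑ i, signBit (pstar i) = 1 := by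
    have hD0 := hneg.ne
    rw [hD, Finset.prod_ne_zero_iff] at hD0
    rw [← signBit_prod _ _ hD0, ← hD, signBit, if_pos hneg]
  rw [sum_redeiMatrix_col, Finset.sum_congr rfl hrec, ← Finset.sum_mul,
    Finset.sum_erase_eq_sub (Finset.mem_univ j), hsum]
  generalize signBit (pstar j) = s
  revert s
  decide
end

section
/- Let p be a prime number and let c ≥ 1 be an integer. Then there are strictly fewer than 2·p^{c/2} fundamental discriminants D < 0 with the property that p splits in K = ℚ(√D) and the ideal class of a prime ideal 𝔭 of O_K above p has order dividing c in the class group Cl(D) (equivalently, 𝔭^c is a principal ideal). -/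
open NumberField

section QuadraticBasis

variable {R S : Type*} [CommRing R] [CommRing S] [Algebra R S]
  (B : Module.Basis (Fin 2) R S) {a b : R}

theorem eq_algebraMap_add_smul_of_basis (h0 : B 0 = 1) (z : S) :
    z = algebraMap R S (B.repr z 0) + B.repr z 1 • B 1 := by
  conv_lhs => rw [← B.sum_repr z]
  rw [Fin.sum_univ_two, h0, Algebra.algebraMap_eq_smul_one]

theorem leftMulMatrix_of_quadratic (h0 : B 0 = 1)
    (h1 : B 1 * B 1 = algebraMap R S a + b • B 1) (r s : R) :
    Algebra.leftMulMatrix B (algebraMap R S r + s • B 1) = !![r, a * s; s, r + b * s] := by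
  have e0 : (algebraMap R S r + s • B 1) * B 0 = r • B 0 + s • B 1 := by
    rw [h0, mul_one, Algebra.algebraMap_eq_smul_one]
  have e1 : (algebraMap R S r + s • B 1) * B 1 = (a * s) • B 0 + (r + b * s) • B 1 := by
    rw [add_mul, smul_mul_assoc, h1, h0]
    simp only [Algebra.smul_def, map_mul, map_add, mul_one]
    ring
  ext i j
  rw [Algebra.leftMulMatrix_eq_repr_mul]
  fin_cases i <;> fin_cases j <;> simp [e0, e1]

theorem trace_of_quadratic (h0 : B 0 = 1)
    (h1 : B 1 * B 1 = algebraMap R S a + b • B 1) (r s : R) :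
    Algebra.trace R S (algebraMap R S r + s • B 1) = 2 * r + b * s := by
  rw [Algebra.trace_eq_matrix_trace B, leftMulMatrix_of_quadratic B h0 h1, Matrix.trace_fin_two]
  simp
  ring

theorem norm_of_quadratic (h0 : B 0 = 1)
    (h1 : B 1 * B 1 = algebraMap R S a + b • B 1) (r s : R) :
    Algebra.norm R (algebraMap R S r + s • B 1) = r ^ 2 + b * r * s - a * s ^ 2 := by
  rw [Algebra.norm_eq_matrix_det B, leftMulMatrix_of_quadratic B h0 h1, Matrix.det_fin_two]
  simp
  ring

theorem discr_of_quadratic (h0 : B 0 = 1)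
    (h1 : B 1 * B 1 = algebraMap R S a + b • B 1) :
    Algebra.discr R B = b ^ 2 + 4 * a := by
  have t0 := trace_of_quadratic B h0 h1 1 0
  have t1 := trace_of_quadratic B h0 h1 0 1
  have t2 := trace_of_quadratic B h0 h1 a b
  rw [← h1] at t2
  simp only [map_one, zero_smul, add_zero, map_zero, one_smul, zero_add] at t0 t1
  rw [Algebra.discr_def, Matrix.det_fin_two]
  simp only [Algebra.traceMatrix_apply, Algebra.traceForm_apply, h0, one_mul, mul_one, t0, t1, t2]
  ring

end QuadraticBasis

section Arithmetic

theorem Squarefree.exists_intCast_eq_of_mul_sq {m : ℤ} (hm : Squarefree m) {u : ℚ} {N : ℤ}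
    (h : (m : ℚ) * u ^ 2 = N) : ∃ v : ℤ, u = v := by
  have hd : (u.den : ℚ) ≠ 0 := by exact_mod_cast u.den_ne_zero
  have h' : m * u.num ^ 2 = N * (u.den : ℤ) ^ 2 := by
    rw [← Rat.num_div_den u, div_pow, mul_div_assoc', div_eq_iff (pow_ne_zero 2 hd)] at h
    exact_mod_cast h
  have hc : IsCoprime ((u.den : ℤ) ^ 2) (u.num ^ 2) :=
    (Int.isCoprime_iff_gcd_eq_one.mpr (by simpa [Int.gcd] using u.reduced)).symm.pow
  have hdvd : (u.den : ℤ) * u.den ∣ m := by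
    rw [← sq]
    exact hc.dvd_of_dvd_mul_right (h' ▸ Dvd.intro_left N rfl)
  have h1 : u.den = 1 := by simpa using Int.isUnit_iff_natAbs_eq.mp (hm _ hdvd)
  exact ⟨u.num, (Rat.den_eq_one_iff u).mp h1 |>.symm⟩

theorem Squarefree.eq_of_mul_sq_eq {m n : ℤ} (hm : Squarefree m) (hn : Squarefree n)
    {s t : ℤ} (hs : s ≠ 0) (h : m * s ^ 2 = n * t ^ 2) : m = n := by
  obtain ⟨v, hv⟩ := hn.exists_intCast_eq_of_mul_sq (u := t / s) (N := m) (by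
    have : (s : ℚ) ≠ 0 := by exact_mod_cast hs
    rw [div_pow, mul_div_assoc', div_eq_iff (pow_ne_zero 2 this)]
    exact_mod_cast h.symm)
  have hs' : (s : ℚ) ≠ 0 := by exact_mod_cast hs
  have ht : t = v * s := by
    rw [div_eq_iff hs'] at hv
    exact_mod_cast hv
  have hmn : m = n * (v * v) := by
    apply mul_right_cancel₀ (pow_ne_zero 2 hs)
    rw [h, ht]
    ring
  have hv1 : IsUnit v := hm v ⟨n, by rw [hmn]; ring⟩
  rw [hmn, Int.isUnit_mul_self hv1, mul_one]

theorem IsFundamentalDiscriminant.eq_of_mul_sq_eq {D E : ℤ} (hD : IsFundamentalDiscriminant D)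
    (hE : IsFundamentalDiscriminant E) {s t : ℤ} (hs : s ≠ 0)
    (h : D * s ^ 2 = E * t ^ 2) : D = E := by
  rcases hD.2 with ⟨hD4, hD⟩ | ⟨m, rfl, hm, hm4⟩ <;>
    rcases hE.2 with ⟨hE4, hE⟩ | ⟨n, rfl, hn, hn4⟩
  · exact hD.eq_of_mul_sq_eq hE hs h
  · have := hD.eq_of_mul_sq_eq hn (t := 2 * t) hs (by linear_combination h)
    omega
  · have := hm.eq_of_mul_sq_eq hE (s := 2 * s) (t := t) (by simpa using hs) (by linear_combination h)
    omega
  · rw [hm.eq_of_mul_sq_eq hn (s := 2 * s) (t := 2 * t) (by simpa using hs)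
      (by linear_combination h)]

theorem IsFundamentalDiscriminant.exists_coeff {D : ℤ} (hD : IsFundamentalDiscriminant D) :
    ∃ a b : ℤ, b ^ 2 + 4 * a = D ∧ ∀ (t n : ℤ) (s : ℚ), (t : ℚ) ^ 2 - 4 * n = D * s ^ 2 →
      ∃ v w : ℤ, s = v ∧ t = 2 * w + b * v := by
  rcases hD.2 with ⟨hD4, hD⟩ | ⟨m, rfl, hm, hm4⟩
  · refine ⟨D / 4, 1, by omega, fun t n s h ↦ ?_⟩
    obtain ⟨v, rfl⟩ := hD.exists_intCast_eq_of_mul_sq (N := t ^ 2 - 4 * n)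
      (by rw [← h]; push_cast; ring)
    have h' : t ^ 2 - 4 * n = D * v ^ 2 := by exact_mod_cast h
    have hpar : Even (t - v) := by
      have h2 : Even ((t - v) * (t + v)) :=
        ⟨2 * n + 2 * (D / 4) * v ^ 2, by
          have : D = 4 * (D / 4) + 1 := by omega
          rw [this] at h'
          linear_combination h'⟩
      rcases Int.even_mul.mp h2 with h2 | h2
      · exact h2
      · rw [Int.even_sub]; exact Int.even_add.mp h2
    obtain ⟨w, hw⟩ := hpar
    exact ⟨v, w, rfl, by omega⟩
  · refine ⟨m, 0, by ring, fun t n s h ↦ ?_⟩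
    obtain ⟨u, hu⟩ := hm.exists_intCast_eq_of_mul_sq (u := 2 * s) (N := t ^ 2 - 4 * n)
      (by push_cast at h ⊢; linear_combination -h)
    have h' : t ^ 2 - 4 * n = m * u ^ 2 := by
      have : (t : ℚ) ^ 2 - 4 * n = m * u ^ 2 := by
        rw [← hu, h]; push_cast; ring
      exact_mod_cast this
    have hmod : (t ^ 2 - m * u ^ 2) % 4 = 0 := by omega
    have key : t % 2 = 0 ∧ u % 2 = 0 := by
      rcases Int.even_or_odd' t with ⟨k, rfl | rfl⟩ <;>
        rcases Int.even_or_odd' u with ⟨l, rfl | rfl⟩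
      · omega
      · exfalso
        have : (2 * k) ^ 2 - m * (2 * l + 1) ^ 2 = 4 * (k ^ 2 - m * l ^ 2 - m * l) - m := by ring
        omega
      · exfalso
        have : (2 * k + 1) ^ 2 - m * (2 * l) ^ 2 = 4 * (k ^ 2 + k - m * l ^ 2) + 1 := by ring
        omega
      · exfalso
        have : (2 * k + 1) ^ 2 - m * (2 * l + 1) ^ 2 =
            4 * (k ^ 2 + k - m * l ^ 2 - m * l) + 1 - m := by ring
        omega
    refine ⟨u / 2, t / 2, ?_, by omega⟩
    have : (u : ℚ) = 2 * (u / 2 : ℤ) := by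
      exact_mod_cast (by omega : u = 2 * (u / 2))
    linear_combination (hu + this) / 2

end Arithmetic

theorem exists_quadratic_field {a b : ℤ} (h : b ^ 2 + 4 * a < 0) :
    ∃ (K : Type) (_ : Field K) (_ : NumberField K) (B : Module.Basis (Fin 2) ℚ K),
      B 0 = 1 ∧ B 1 * B 1 = algebraMap ℚ K a + (b : ℚ) • B 1 := by
  have hF : Fact (∀ r : ℚ, r ^ 2 ≠ a + b * r) := ⟨fun r hr ↦ by
    have h' : (b : ℚ) ^ 2 + 4 * a < 0 := by exact_mod_cast h
    nlinarith [sq_nonneg (2 * r - b)]⟩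
  have hfin : FiniteDimensional ℚ (QuadraticAlgebra ℚ (a : ℚ) (b : ℚ)) :=
    Module.Finite.of_basis (QuadraticAlgebra.basis (a : ℚ) (b : ℚ))
  refine ⟨QuadraticAlgebra ℚ (a : ℚ) (b : ℚ), inferInstance, { to_finiteDimensional := hfin },
    QuadraticAlgebra.basis (a : ℚ) (b : ℚ), ?_, ?_⟩
  · ext <;> simp [QuadraticAlgebra.basis, QuadraticAlgebra.re_one, QuadraticAlgebra.im_one]
  · ext <;> simp [QuadraticAlgebra.basis]

theorem IsFundamentalDiscriminant.exists_numberField {D : ℤ} (hD : IsFundamentalDiscriminant D)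
    (hneg : D < 0) :
    ∃ (K : Type) (_ : Field K) (_ : NumberField K), Module.finrank ℚ K = 2 ∧ discr K = D ∧
      ∀ α : 𝓞 K, ∃ t s : ℤ, t ^ 2 - 4 * Algebra.norm ℤ α = D * s ^ 2 ∧
        α ^ 2 - t * α + Algebra.norm ℤ α = 0 := by
  obtain ⟨a, b, rfl, hab⟩ := hD.exists_coeff
  obtain ⟨K, _, _, B, h0, h1⟩ := exists_quadratic_field hneg
  have hω : IsIntegral ℤ (B 1) := by
    refine ⟨Polynomial.X ^ 2 - Polynomial.C b * Polynomial.X - Polynomial.C a, by monicity!, ?_⟩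
    have : B 1 * B 1 = a + b * B 1 := by simpa [Algebra.smul_def] using h1
    simp only [← Polynomial.aeval_def, map_sub, map_pow, map_mul, Polynomial.aeval_X,
      eq_intCast, map_intCast]
    linear_combination this
  let ω : 𝓞 K := ⟨B 1, hω⟩
  have hωK : ((ω : 𝓞 K) : K) = B 1 := rfl
  have hω2 : ω * ω = algebraMap ℤ (𝓞 K) a + b • ω := by
    apply RingOfIntegers.ext
    simpa [hωK, Algebra.smul_def] using h1
  have htrace (α : 𝓞 K) : (Algebra.trace ℤ (𝓞 K) α : ℚ) =
      2 * B.repr α 0 + b * B.repr α 1 := by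
    rw [Algebra.coe_trace_int, ← trace_of_quadratic B h0 h1,
      ← eq_algebraMap_add_smul_of_basis B h0]
  have hnorm (α : 𝓞 K) : (Algebra.norm ℤ α : ℚ) =
      B.repr α 0 ^ 2 + b * B.repr α 0 * B.repr α 1 - a * B.repr α 1 ^ 2 := by
    rw [Algebra.coe_norm_int, ← norm_of_quadratic B h0 h1,
      ← eq_algebraMap_add_smul_of_basis B h0]
  have hcoord (α : 𝓞 K) : ∃ r s : ℤ, B.repr α 0 = r ∧ B.repr α 1 = s := by
    obtain ⟨v, w, hv, hw⟩ := hab (Algebra.trace ℤ (𝓞 K) α) (Algebra.norm ℤ α) (B.repr α 1)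
      (by rw [htrace, hnorm]; push_cast; ring)
    refine ⟨w, v, ?_, hv⟩
    have hw' : (Algebra.trace ℤ (𝓞 K) α : ℚ) = 2 * w + b * v := by exact_mod_cast hw
    rw [htrace, hv] at hw'
    linarith
  have hexp (α : 𝓞 K) (r s : ℤ) (hr : B.repr α 0 = r) (hs : B.repr α 1 = s) :
      α = r • 1 + s • ω := by
    apply RingOfIntegers.ext
    have := eq_algebraMap_add_smul_of_basis B h0 (α : K)
    rw [hr, hs] at this
    simpa [hωK, Algebra.smul_def] using this
  have hli : LinearIndependent ℤ ![1, ω] := by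
    rw [LinearIndependent.pair_iff]
    intro s t hst
    have hK : (s : ℚ) • B 0 + (t : ℚ) • B 1 = 0 := by
      have := congrArg (algebraMap (𝓞 K) K) hst
      simpa [hωK, h0, Algebra.smul_def] using this
    have := congrArg B.repr hK
    exact ⟨by simpa using DFunLike.congr_fun this 0, by simpa using DFunLike.congr_fun this 1⟩
  let C : Module.Basis (Fin 2) ℤ (𝓞 K) := .mk hli (by
    intro α _
    obtain ⟨r, s, hr, hs⟩ := hcoord α
    rw [hexp α r s hr hs, Matrix.range_cons, Matrix.range_cons, Matrix.range_empty]
    simpa using Submodule.mem_span_pair.mpr ⟨s, r, by simp [add_comm]⟩)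
  have hC0 : C 0 = 1 := by simp [C]
  have hC1 : C 1 = ω := by simp [C]
  have hC2 : C 1 * C 1 = algebraMap ℤ (𝓞 K) a + b • C 1 := by rw [hC1, hω2]
  refine ⟨K, inferInstance, inferInstance, ?_, ?_, fun α ↦ ?_⟩
  · rw [Module.finrank_eq_card_basis B, Fintype.card_fin]
  · rw [← discr_eq_discr K C, discr_of_quadratic C hC0 hC2]
  · have hα := eq_algebraMap_add_smul_of_basis C hC0 α
    set r := C.repr α 0
    set s := C.repr α 1
    have hN := norm_of_quadratic C hC0 hC2 r s
    rw [← hα] at hN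
    refine ⟨2 * r + b * s, s, by rw [hN]; ring, ?_⟩
    rw [hN, hα, hC1]
    simp only [Algebra.smul_def, eq_intCast, Int.cast_add, Int.cast_mul, Int.cast_sub,
      Int.cast_pow, Int.cast_ofNat] at hω2 ⊢
    linear_combination (s : 𝓞 K) ^ 2 * hω2

section Ideals

variable {K : Type*} [Field K] [NumberField K] {P Q : Ideal (𝓞 K)}

theorem natAbs_norm_eq_of_span_eq_pow {q : ℕ} (hq : q.Prime)
    (hK : Module.finrank ℚ K = 2) (hP : P.IsPrime) (hQ : Q.IsPrime)
    (h : Ideal.span {(q : 𝓞 K)} = P * Q) {c : ℕ} {α : 𝓞 K} (hα : P ^ c = Ideal.span {α}) :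
    (Algebra.norm ℤ α).natAbs = q ^ c := by
  have hmul : Ideal.absNorm P * Ideal.absNorm Q = q ^ 2 := by
    rw [← map_mul, ← h, Ideal.absNorm_span_singleton]
    have : Algebra.norm ℤ (q : 𝓞 K) = q ^ 2 := by
      have := Algebra.norm_algebraMap_of_basis (RingOfIntegers.basis K) (q : ℤ)
      rw [← Module.finrank_eq_card_basis (RingOfIntegers.basis K), RingOfIntegers.rank, hK] at this
      simpa using this
    rw [this]
    simp
  have hP1 : Ideal.absNorm P ≠ 1 := fun h1 ↦ hP.ne_top (Ideal.absNorm_eq_one_iff.mp h1)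
  have hQ1 : Ideal.absNorm Q ≠ 1 := fun h1 ↦ hQ.ne_top (Ideal.absNorm_eq_one_iff.mp h1)
  rw [← Ideal.absNorm_span_singleton, ← hα, map_pow]
  rw [((Nat.Prime.mul_eq_prime_sq_iff hq hP1 hQ1).mp hmul).1]

theorem span_sq_ne_of_span_eq_pow {q : ℕ} (hq : q ≠ 0) (hPQ : P ≠ Q) (hP : P.IsPrime)
    (hQ : Q.IsPrime) (h : Ideal.span {(q : 𝓞 K)} = P * Q) {c : ℕ} (hc : c ≠ 0) {α : 𝓞 K}
    (hα : P ^ c = Ideal.span {α}) : Ideal.span {α ^ 2} ≠ Ideal.span {(q : 𝓞 K) ^ c} := by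
  intro heq
  rw [← Ideal.span_singleton_pow, ← Ideal.span_singleton_pow, h, ← hα, mul_pow, sq] at heq
  have hP0 : P ≠ ⊥ := by
    rintro rfl
    rw [Ideal.bot_mul, Ideal.span_singleton_eq_bot] at h
    exact hq (by exact_mod_cast h)
  have hpow : P ^ c = Q ^ c := mul_left_cancel₀ (pow_ne_zero c hP0) heq
  exact hPQ (le_antisymm (hQ.le_of_pow_le (hpow.trans_le (Ideal.pow_le_self hc)))
    (hP.le_of_pow_le (hpow.symm.trans_le (Ideal.pow_le_self hc))))

end Ideals

theorem IsFundamentalDiscriminant.exists_sq_sub_eq {q c : ℕ} (hq : q.Prime) (hc : c ≠ 0) {D : ℤ}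
    (hD : IsFundamentalDiscriminant D) (hneg : D < 0)
    (h : ∀ (K : Type) [Field K] [NumberField K], Module.finrank ℚ K = 2 → discr K = D →
      ∃ P Q : Ideal (𝓞 K), P ≠ Q ∧ P.IsPrime ∧ Q.IsPrime ∧
        Ideal.span {(q : 𝓞 K)} = P * Q ∧ (P ^ c).IsPrincipal) :
    ∃ x : ℕ, 0 < x ∧ x ^ 2 < 4 * q ^ c ∧ ∃ s : ℤ, (x : ℤ) ^ 2 - 4 * q ^ c = D * s ^ 2 := by
  obtain ⟨K, _, _, hK, hdisc, hform⟩ := hD.exists_numberField hneg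
  obtain ⟨P, Q, hPQ, hP, hQ, hspan, ⟨α, hα⟩⟩ := h K hK hdisc
  replace hα : P ^ c = Ideal.span {α} := hα
  obtain ⟨t, s, hts, hroot⟩ := hform α
  have hne := span_sq_ne_of_span_eq_pow hq.ne_zero hPQ hP hQ hspan hc hα
  have hN : Algebra.norm ℤ α = q ^ c := by
    have h1 := natAbs_norm_eq_of_span_eq_pow hq hK hP hQ hspan hα
    have h2 : 0 ≤ Algebra.norm ℤ α := by nlinarith [sq_nonneg t, sq_nonneg s]
    rw [← Int.natAbs_of_nonneg h2, h1]
    push_cast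
    rfl
  rw [hN] at hts hroot
  push_cast at hroot
  have ht : t ≠ 0 := by
    rintro rfl
    apply hne
    rw [← Ideal.span_singleton_neg ((q : 𝓞 K) ^ c)]
    congr 2
    simpa [add_eq_zero_iff_eq_neg] using hroot
  have hs : s ≠ 0 := by
    rintro rfl
    apply hne
    have ht4 : (t : 𝓞 K) ^ 2 - 4 * q ^ c = 0 := by
      have := congrArg (Int.cast (R := 𝓞 K)) hts
      simpa using this
    have h2 : (2 * α - t) ^ 2 = 0 := by linear_combination 4 * hroot + ht4
    have h2' : 2 * α - t = 0 := by simpa using h2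
    have h4 : (4 : 𝓞 K) * α ^ 2 = 4 * q ^ c := by linear_combination (2 * α + t) * h2' + ht4
    rw [mul_left_cancel₀ (by norm_num) h4]
  refine ⟨t.natAbs, Int.natAbs_pos.mpr ht, ?_, s, by rw [Int.natCast_natAbs, sq_abs, hts]⟩
  zify
  rw [sq_abs]
  nlinarith [mul_neg_of_neg_of_pos hneg (sq_pos_of_ne_zero hs)]

/-- For a prime `p` and an integer `c ≥ 1`, there are strictly fewer than `2·p^{c/2}`
fundamental discriminants `D < 0` such that `p` splits in `K = ℚ(√D)` and the class of a
prime ideal above `p` has order dividing `c` in the class group (i.e. `𝔭^c` is principal). -/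
theorem count_split_with_small_order_lt (q : ℕ) (hq : q.Prime) (c : ℕ) (hc : 1 ≤ c) :
    {D : ℤ | IsFundamentalDiscriminant D ∧ D < 0 ∧
      ∀ (K : Type) [Field K] [NumberField K], Module.finrank ℚ K = 2 →
        NumberField.discr K = D →
          ∃ P Q : Ideal (𝓞 K), P ≠ Q ∧ P.IsPrime ∧ Q.IsPrime ∧
            Ideal.span {(q : 𝓞 K)} = P * Q ∧ (P ^ c).IsPrincipal}.Finite ∧
    (({D : ℤ | IsFundamentalDiscriminant D ∧ D < 0 ∧
      ∀ (K : Type) [Field K] [NumberField K], Module.finrank ℚ K = 2 →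
        NumberField.discr K = D →
          ∃ P Q : Ideal (𝓞 K), P ≠ Q ∧ P.IsPrime ∧ Q.IsPrime ∧
            Ideal.span {(q : 𝓞 K)} = P * Q ∧ (P ^ c).IsPrincipal}.ncard : ℝ)
      < 2 * (q : ℝ) ^ ((c : ℝ) / 2)) := by
  choose! f hf0 hflt g hfg using fun D (hD : D ∈ {D : ℤ | IsFundamentalDiscriminant D ∧ D < 0 ∧
      ∀ (K : Type) [Field K] [NumberField K], Module.finrank ℚ K = 2 →
        NumberField.discr K = D →
          ∃ P Q : Ideal (𝓞 K), P ≠ Q ∧ P.IsPrime ∧ Q.IsPrime ∧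
            Ideal.span {(q : 𝓞 K)} = P * Q ∧ (P ^ c).IsPrincipal}) ↦
    hD.1.exists_sq_sub_eq hq (by omega) hD.2.1 hD.2.2
  set S := {D : ℤ | IsFundamentalDiscriminant D ∧ D < 0 ∧
      ∀ (K : Type) [Field K] [NumberField K], Module.finrank ℚ K = 2 →
        NumberField.discr K = D →
          ∃ P Q : Ideal (𝓞 K), P ≠ Q ∧ P.IsPrime ∧ Q.IsPrime ∧
            Ideal.span {(q : 𝓞 K)} = P * Q ∧ (P ^ c).IsPrincipal}
  set M : ℝ := 2 * (q : ℝ) ^ ((c : ℝ) / 2)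
  have hq0 : (0 : ℝ) < q := by exact_mod_cast hq.pos
  have hM : 0 < M := by positivity
  have hM2 : M ^ 2 = 4 * (q : ℝ) ^ c := by
    rw [mul_pow, ← Real.rpow_natCast ((q : ℝ) ^ ((c : ℝ) / 2)), ← Real.rpow_mul hq0.le,
      ← Real.rpow_natCast (q : ℝ) c]
    norm_num
  have hmaps : Set.MapsTo f S (Finset.Ioo 0 ⌈M⌉₊ : Finset ℕ) := fun D hD ↦ by
    rw [Finset.mem_coe, Finset.mem_Ioo, Nat.lt_ceil]
    refine ⟨hf0 D hD, lt_of_pow_lt_pow_left₀ 2 hM.le ?_⟩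
    rw [hM2]
    exact_mod_cast hflt D hD
  have hinj : Set.InjOn f S := fun D hD E hE hDE ↦ by
    have hgD := hfg D hD
    have hgE := hfg E hE
    have hlt : (f D : ℤ) ^ 2 < 4 * q ^ c := by exact_mod_cast hflt D hD
    refine hD.1.eq_of_mul_sq_eq hE.1 (s := g D) (t := g E) (fun h0 ↦ ?_)
      (by rw [← hgD, ← hgE, hDE])
    rw [h0] at hgD
    linarith
  refine ⟨.of_finite_image ((Finset.finite_toSet _).subset hmaps.image_subset) hinj, ?_⟩
  have hcard := Set.ncard_le_ncard_of_injOn f hmaps hinj (Finset.finite_toSet _)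
  rw [Set.ncard_coe_finset, Nat.card_Ioo] at hcard
  have hceil : 0 < ⌈M⌉₊ := Nat.ceil_pos.mpr hM
  exact Nat.lt_ceil.mp (by omega)
end
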